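/- arXiv:q-alg/9702013 — 2 statements merged into one kernel-verified Lean document; each statement's English description precedes it below -/
import Mathlib

section
/- With notation as above, the monomials Det_1^{l_1} · Det_2^{l_2} · ... · Det_n^{l_n} with all l_i ∈ ℤ_{≥0} are singular vectors for the adjoint action of gl_n^{(1)} ⊕ gl_n^{(2)} on S(a₋), and every singular vector in S(a₋) is a linear combination of such monomials. -/
/-
STATEMENT 1: The monomials Det_1^{l_1} ⋯ Det_n^{l_n} (l_i ∈ ℕ) are singular vectors
for the adjoint action of gl_n^{(1)} ⊕ gl_n^{(2)} on S(a₋), and every singular vector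
is a linear combination of such monomials.
-/

noncomputable section

/-- The symmetric algebra `S(a₋)`: the variable `(i, j)` stands for `E_{n+i, j}` (0-indexed). -/
abbrev SA (n : ℕ) := MvPolynomial (Fin n × Fin n) ℂ

def lo (n : ℕ) (j : Fin n) : Fin (2 * n) := ⟨j, by have := j.isLt; omega⟩

def hi (n : ℕ) (i : Fin n) : Fin (2 * n) := ⟨n + i, by have := i.isLt; omega⟩

/-- The adjoint action of a block-diagonal matrix on `S(a₋)`, extended as a derivation from
`ad A (E_{n+i,j}) = ∑_{i'} A_{n+i', n+i} E_{n+i', j} - ∑_{j'} A_{j, j'} E_{n+i, j'}`. -/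
def adAct (n : ℕ) (A : Matrix (Fin (2 * n)) (Fin (2 * n)) ℂ) (p : SA n) : SA n :=
  ∑ v : Fin n × Fin n,
    ((∑ i' : Fin n, MvPolynomial.C (A (hi n i') (hi n v.1)) * MvPolynomial.X (i', v.2)) -
      (∑ j' : Fin n, MvPolynomial.C (A (lo n v.2) (lo n j')) * MvPolynomial.X (v.1, j'))) *
      MvPolynomial.pderiv v p

/-- `Det_k` (1 ≤ k ≤ n): determinant of the `k×k` corner submatrix of matrix units. -/
def DetP (n k : ℕ) (hk : k ≤ n) : SA n :=
  Matrix.det (Matrix.of fun a b : Fin k =>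
    MvPolynomial.X (⟨a, by have := a.isLt; omega⟩, ⟨n - k + b, by have := b.isLt; omega⟩))

/-- `A` is block-diagonal with both diagonal blocks strictly upper triangular. -/
def IsStrictUpperBlockDiag (n : ℕ) (A : Matrix (Fin (2 * n)) (Fin (2 * n)) ℂ) : Prop :=
  ∀ p q : Fin (2 * n), A p q ≠ 0 → (p : ℕ) < (q : ℕ) ∧ ((p : ℕ) < n ↔ (q : ℕ) < n)

/-- `p ∈ S(a₋)` is a singular vector: it is annihilated by the adjoint action of every
strictly upper triangular element of `gl_n^{(1)} ⊕ gl_n^{(2)}`. -/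
def IsSingular (n : ℕ) (p : SA n) : Prop :=
  ∀ A : Matrix (Fin (2 * n)) (Fin (2 * n)) ℂ, IsStrictUpperBlockDiag n A → adAct n A p = 0

/-- All entries on and above the diagonal vanish. -/
def IsStrictLower {n : ℕ} (N : Matrix (Fin n) (Fin n) ℂ) : Prop :=
  ∀ i j, i ≤ j → N i j = 0

/-- Evaluation of `p ∈ S(a₋)` at a matrix. -/
def evalMat {n : ℕ} (X : Matrix (Fin n) (Fin n) ℂ) : SA n →+* ℂ :=
  MvPolynomial.eval fun v => X v.1 v.2

/-- The top right `k × k` corner of a matrix. -/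
def corner {n k : ℕ} (hk : k ≤ n) (X : Matrix (Fin n) (Fin n) ℂ) : Matrix (Fin k) (Fin k) ℂ :=
  Matrix.of fun a b =>
    X ⟨a, by have := a.isLt; omega⟩ ⟨n - k + b, by have := b.isLt; omega⟩

theorem evalMat_DetP {n k : ℕ} (hk : k ≤ n) (X : Matrix (Fin n) (Fin n) ℂ) :
    evalMat X (DetP n k hk) = (corner hk X).det := by
  rw [DetP, RingHom.map_det]
  congr 1
  ext a b
  simp [evalMat, corner]

theorem hasDerivAt_eval {σ : Type*} [Fintype σ] (p : MvPolynomial σ ℂ) {γ : ℂ → σ → ℂ}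
    {γ' : σ → ℂ} {t : ℂ} (h : ∀ v, HasDerivAt (fun s => γ s v) (γ' v) t) :
    HasDerivAt (fun s => MvPolynomial.eval (γ s) p)
      (∑ v, γ' v * MvPolynomial.eval (γ t) (MvPolynomial.pderiv v p)) t := by
  classical
  induction p using MvPolynomial.induction_on with
  | C a => simpa using hasDerivAt_const t a
  | add p q hp hq =>
    simp only [map_add, mul_add, Finset.sum_add_distrib]
    exact hp.add hq
  | mul_X p i hp =>
    simp only [map_mul, MvPolynomial.eval_X]
    refine (hp.mul (h i)).congr_deriv ?_
    simp only [Derivation.leibniz, MvPolynomial.pderiv_X, smul_eq_mul, map_add, map_mul,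
      MvPolynomial.eval_X, mul_add, Finset.sum_add_distrib, Finset.sum_mul]
    rw [add_comm]
    congr 1
    · rw [Finset.sum_eq_single i]
      · simp
        ring
      · intro j _ hj
        simp [hj.symm]
      · simp
    · exact Finset.sum_congr rfl fun v _ => by ring

theorem path_apply {n : ℕ} (N M X : Matrix (Fin n) (Fin n) ℂ) (t : ℂ) (i j : Fin n) :
    ((1 + t • N) * X * (1 + t • M)) i j =
      X i j + t * (N * X + X * M) i j + t ^ 2 * (N * X * M) i j := by
  have : (1 + t • N) * X * (1 + t • M) = X + t • (N * X + X * M) + t ^ 2 • (N * X * M) := by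
    simp only [add_mul, mul_add, one_mul, mul_one, smul_mul_assoc, mul_smul_comm, smul_smul,
      smul_add, pow_two]
    abel
  simp [this, mul_add]

theorem hasDerivAt_evalMat_path {n : ℕ} (p : SA n) (N M X : Matrix (Fin n) (Fin n) ℂ) (t : ℂ) :
    HasDerivAt (fun s : ℂ => evalMat ((1 + s • N) * X * (1 + s • M)) p)
      (∑ v : Fin n × Fin n, (N * X * (1 + t • M) + (1 + t • N) * X * M) v.1 v.2 *
        evalMat ((1 + t • N) * X * (1 + t • M)) (MvPolynomial.pderiv v p)) t := by
  refine hasDerivAt_eval p fun v => ?_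
  simp only [path_apply]
  have h1 := ((hasDerivAt_id t).mul_const ((N * X + X * M) v.1 v.2)).const_add (X v.1 v.2)
  have h2 := ((hasDerivAt_id t).pow 2).mul_const ((N * X * M) v.1 v.2)
  refine (h1.add h2).congr_deriv ?_
  have : N * X * (1 + t • M) + (1 + t • N) * X * M =
      (N * X + X * M) + (2 * t) • (N * X * M) := by
    simp only [add_mul, mul_add, one_mul, mul_one, smul_mul_assoc, mul_smul_comm, two_mul,
      add_smul]
    abel
  rw [this]
  simp

/-- The vector field on matrices defined by `adAct`. -/
theorem evalMat_adAct {n : ℕ} (A : Matrix (Fin (2 * n)) (Fin (2 * n)) ℂ) (p : SA n)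
    (X N M : Matrix (Fin n) (Fin n) ℂ) (hN : ∀ i i', A (hi n i') (hi n i) = N i i')
    (hM : ∀ j j', A (lo n j) (lo n j') = - M j' j) :
    evalMat X (adAct n A p) =
      ∑ v : Fin n × Fin n, (N * X + X * M) v.1 v.2 * evalMat X (MvPolynomial.pderiv v p) := by
  rw [adAct, map_sum]
  refine Finset.sum_congr rfl fun v _ => ?_
  rw [map_mul]
  congr 1
  simp [evalMat, hN, hM, Matrix.mul_apply, mul_comm]

theorem exists_blockDiag {n : ℕ} {N M : Matrix (Fin n) (Fin n) ℂ} (hN : IsStrictLower N)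
    (hM : IsStrictLower M) :
    ∃ A : Matrix (Fin (2 * n)) (Fin (2 * n)) ℂ, IsStrictUpperBlockDiag n A ∧
      (∀ i i', A (hi n i') (hi n i) = N i i') ∧ ∀ j j', A (lo n j) (lo n j') = - M j' j := by
  refine ⟨Matrix.of fun p q =>
    if h : (p : ℕ) < n ∧ (q : ℕ) < n then - M ⟨q, h.2⟩ ⟨p, h.1⟩
    else if h : n ≤ (p : ℕ) ∧ n ≤ (q : ℕ) then
      N ⟨q - n, by have := q.isLt; omega⟩ ⟨p - n, by have := p.isLt; omega⟩
    else 0, ?_, ?_, ?_⟩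
  · intro p q h
    simp only [Matrix.of_apply] at h
    split_ifs at h with h1 h2
    · have : ¬ (⟨q, h1.2⟩ : Fin n) ≤ ⟨p, h1.1⟩ := fun h' => h (by rw [hM _ _ h', neg_zero])
      simp only [Fin.mk_le_mk] at this
      omega
    · have : ¬ (⟨q - n, by have := q.isLt; omega⟩ : Fin n) ≤
          ⟨p - n, by have := p.isLt; omega⟩ := fun h' => h (hN _ _ h')
      simp only [Fin.mk_le_mk] at this
      omega
    · exact absurd rfl h
  · intro i i'
    simp [hi]
  · intro j j'
    simp [lo]

theorem IsStrictLower.lowerTriangular {n : ℕ} {N : Matrix (Fin n) (Fin n) ℂ}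
    (hN : IsStrictLower N) (t : ℂ) :
    (1 + t • N).BlockTriangular OrderDual.toDual := by
  intro i j hij
  have hij : i < j := hij
  simp [hN i j hij.le, hij.ne]

theorem IsStrictLower.det_one_add {n : ℕ} {N : Matrix (Fin n) (Fin n) ℂ}
    (hN : IsStrictLower N) (t : ℂ) : (1 + t • N).det = 1 := by
  rw [Matrix.det_of_isLowerTriangular _ (hN.lowerTriangular t)]
  simp [hN _ _ le_rfl]

theorem IsStrictLower.inv_lowerTriangular {n : ℕ} {N : Matrix (Fin n) (Fin n) ℂ}
    (hN : IsStrictLower N) (t : ℂ) :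
    (1 + t • N)⁻¹.BlockTriangular OrderDual.toDual := by
  have : Invertible (1 + t • N) :=
    Matrix.invertibleOfIsUnitDet _ (by rw [hN.det_one_add]; exact isUnit_one)
  exact Matrix.blockTriangular_inv_of_blockTriangular (hN.lowerTriangular t)

theorem IsStrictLower.mul_lower {n : ℕ} {N K : Matrix (Fin n) (Fin n) ℂ}
    (hN : IsStrictLower N) (hK : K.BlockTriangular OrderDual.toDual) : IsStrictLower (N * K) := by
  intro i j hij
  rw [Matrix.mul_apply]
  refine Finset.sum_eq_zero fun k _ => ?_
  rcases le_or_gt i k with h | h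
  · rw [hN i k h, zero_mul]
  · rw [hK (show OrderDual.toDual j < OrderDual.toDual k from h.trans_le hij), mul_zero]

theorem IsStrictLower.lower_mul {n : ℕ} {N K : Matrix (Fin n) (Fin n) ℂ}
    (hN : IsStrictLower N) (hK : K.BlockTriangular OrderDual.toDual) : IsStrictLower (K * N) := by
  intro i j hij
  rw [Matrix.mul_apply]
  refine Finset.sum_eq_zero fun k _ => ?_
  rcases le_or_gt k j with h | h
  · rw [hN k j h, mul_zero]
  · rw [hK (show OrderDual.toDual k < OrderDual.toDual i from hij.trans_lt h), zero_mul]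

/-- A singular vector is invariant under the unipotent group. -/
theorem IsSingular.evalMat_mul {n : ℕ} {p : SA n} (hp : IsSingular n p)
    {N M : Matrix (Fin n) (Fin n) ℂ} (hN : IsStrictLower N) (hM : IsStrictLower M)
    (X : Matrix (Fin n) (Fin n) ℂ) :
    evalMat ((1 + N) * X * (1 + M)) p = evalMat X p := by
  have key : ∀ t : ℂ,
      HasDerivAt (fun s : ℂ => evalMat ((1 + s • N) * X * (1 + s • M)) p) 0 t := by
    intro t
    refine (hasDerivAt_evalMat_path p N M X t).congr_deriv ?_
    have uN : IsUnit (1 + t • N).det := by rw [hN.det_one_add]; exact isUnit_one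
    have uM : IsUnit (1 + t • M).det := by rw [hM.det_one_add]; exact isUnit_one
    obtain ⟨A, hA, h1, h2⟩ := exists_blockDiag (hN.mul_lower (hN.inv_lowerTriangular t))
      (hM.lower_mul (hM.inv_lowerTriangular t))
    have h := evalMat_adAct A p ((1 + t • N) * X * (1 + t • M)) _ _ h1 h2
    rw [hp A hA, map_zero] at h
    have hNX : N * (1 + t • N)⁻¹ * ((1 + t • N) * X * (1 + t • M)) = N * X * (1 + t • M) := by
      rw [Matrix.mul_assoc N, Matrix.mul_assoc (1 + t • N),
        Matrix.nonsing_inv_mul_cancel_left _ _ uN, Matrix.mul_assoc]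
    have hXM : (1 + t • N) * X * (1 + t • M) * ((1 + t • M)⁻¹ * M) = (1 + t • N) * X * M := by
      rw [← Matrix.mul_assoc _ (1 + t • M)⁻¹, Matrix.mul_nonsing_inv_cancel_right _ _ uM]
    rw [h, hNX, hXM]
  have := is_const_of_deriv_eq_zero (fun t => (key t).differentiableAt)
    (fun t => (key t).deriv) 1 0
  simpa using this

theorem sum_eq_sum_castLE {n k : ℕ} (hk : k ≤ n) (f : Fin n → ℂ)
    (hf : ∀ a : Fin n, k ≤ (a : ℕ) → f a = 0) :
    ∑ a, f a = ∑ a : Fin k, f ⟨a, by have := a.isLt; omega⟩ := by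
  refine (Fintype.sum_of_injective (fun a : Fin k => (⟨a, by have := a.isLt; omega⟩ : Fin n))
    (fun a b h => by simpa [Fin.ext_iff] using h) _ _ (fun a ha => hf a ?_) fun _ => rfl).symm
  by_contra h
  exact ha ⟨⟨a, by omega⟩, rfl⟩

theorem sum_eq_sum_last {n k : ℕ} (hk : k ≤ n) (f : Fin n → ℂ)
    (hf : ∀ a : Fin n, (a : ℕ) < n - k → f a = 0) :
    ∑ a, f a = ∑ a : Fin k, f ⟨n - k + a, by have := a.isLt; omega⟩ := by
  refine (Fintype.sum_of_injective
    (fun a : Fin k => (⟨n - k + a, by have := a.isLt; omega⟩ : Fin n))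
    (fun a b h => by simpa [Fin.ext_iff] using h) _ _ (fun a ha => hf a ?_) fun _ => rfl).symm
  by_contra h
  exact ha ⟨⟨a - (n - k), by have := a.isLt; omega⟩, by
    simp only [Fin.ext_iff]; omega⟩

/-- Corner minors are invariant under the unipotent group. -/
theorem det_corner_mul {n k : ℕ} (hk : k ≤ n) {N M : Matrix (Fin n) (Fin n) ℂ}
    (hN : IsStrictLower N) (hM : IsStrictLower M) (X : Matrix (Fin n) (Fin n) ℂ) :
    (corner hk ((1 + N) * X * (1 + M))).det = (corner hk X).det := by
  let e : Fin k → Fin n := fun a => ⟨a, by have := a.isLt; omega⟩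
  let f : Fin k → Fin n := fun a => ⟨n - k + a, by have := a.isLt; omega⟩
  have he : Function.Injective e := fun a b h => by simpa [e, Fin.ext_iff] using h
  have hf : Function.Injective f := fun a b h => by simpa [f, Fin.ext_iff] using h
  have hc : corner hk ((1 + N) * X * (1 + M)) =
      (1 + (1 : ℂ) • N.submatrix e e) * corner hk X * (1 + (1 : ℂ) • M.submatrix f f) := by
    have h1 : (1 + (1 : ℂ) • N.submatrix e e) = (1 + N).submatrix e e := by
      rw [one_smul, Matrix.submatrix_add, Pi.add_apply, Pi.add_apply, Matrix.submatrix_one e he]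
    have h2 : (1 + (1 : ℂ) • M.submatrix f f) = (1 + M).submatrix f f := by
      rw [one_smul, Matrix.submatrix_add, Pi.add_apply, Pi.add_apply, Matrix.submatrix_one f hf]
    rw [h1, h2]
    ext a b
    rw [corner, Matrix.of_apply, Matrix.mul_apply, Matrix.mul_apply, sum_eq_sum_last hk]
    · refine Finset.sum_congr rfl fun c _ => ?_
      congr 1
      rw [Matrix.mul_apply, Matrix.mul_apply, sum_eq_sum_castLE hk]
      · rfl
      · intro d hd
        have hlt : e a < d := Fin.lt_def.2 (by have := a.isLt; simp only [e]; omega)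
        have h0 := hN.lowerTriangular 1 (show OrderDual.toDual d < OrderDual.toDual (e a) from hlt)
        rw [one_smul] at h0
        exact mul_eq_zero_of_left h0 _
    · intro c hcl
      have hlt : c < f b := Fin.lt_def.2 (by simp only [f]; omega)
      have h0 := hM.lowerTriangular 1 (show OrderDual.toDual (f b) < OrderDual.toDual c from hlt)
      rw [one_smul] at h0
      exact mul_eq_zero_of_right _ h0
  have hN' : IsStrictLower (N.submatrix e e) := fun a b h => hN _ _ h
  have hM' : IsStrictLower (M.submatrix f f) := fun a b h =>
    hM _ _ (Fin.le_def.2 (Nat.add_le_add_left h _))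
  rw [hc, Matrix.det_mul, Matrix.det_mul, hN'.det_one_add, hM'.det_one_add, one_mul, mul_one]

theorem isSingular_DetP {n k : ℕ} (hk : k ≤ n) : IsSingular n (DetP n k hk) := by
  intro A hA
  let N : Matrix (Fin n) (Fin n) ℂ := Matrix.of fun i i' => A (hi n i') (hi n i)
  let M : Matrix (Fin n) (Fin n) ℂ := Matrix.of fun j' j => - A (lo n j) (lo n j')
  have hN : IsStrictLower N := by
    intro i j hij
    by_contra h
    have := (hA _ _ h).1
    simp only [hi] at this
    have := Fin.le_def.1 hij
    omega
  have hM : IsStrictLower M := by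
    intro i j hij
    by_contra h
    have := (hA _ _ (neg_ne_zero.1 h)).1
    simp only [lo] at this
    have := Fin.le_def.1 hij
    omega
  refine MvPolynomial.funext fun x => ?_
  let X : Matrix (Fin n) (Fin n) ℂ := Matrix.of fun i j => x (i, j)
  have hd := hasDerivAt_evalMat_path (DetP n k hk) N M X 0
  have hconst : ∀ s : ℂ, evalMat ((1 + s • N) * X * (1 + s • M)) (DetP n k hk) =
      evalMat X (DetP n k hk) := by
    intro s
    rw [evalMat_DetP, evalMat_DetP]
    refine det_corner_mul hk (fun i j h => ?_) (fun i j h => ?_) X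
    · simp [hN i j h]
    · simp [hM i j h]
  simp only [hconst] at hd
  have h0 := hd.unique (hasDerivAt_const 0 _)
  have := evalMat_adAct A (DetP n k hk) X N M (fun _ _ => rfl) (fun _ _ => by simp [M])
  simp only [zero_smul, add_zero, one_mul, mul_one] at h0
  rw [h0] at this
  simpa [evalMat, X] using this

theorem IsSingular.one (n : ℕ) : IsSingular n 1 := fun A _ => by simp [adAct]

theorem IsSingular.mul {n : ℕ} {p q : SA n} (hp : IsSingular n p) (hq : IsSingular n q) :
    IsSingular n (p * q) := by
  intro A hA
  have : adAct n A (p * q) = p * adAct n A q + q * adAct n A p := by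
    simp only [adAct, Derivation.leibniz, smul_eq_mul, Finset.mul_sum, ← Finset.sum_add_distrib]
    exact Finset.sum_congr rfl fun v _ => by ring
  rw [this, hp A hA, hq A hA, mul_zero, mul_zero, add_zero]

theorem IsSingular.pow {n : ℕ} {p : SA n} (hp : IsSingular n p) (l : ℕ) :
    IsSingular n (p ^ l) := by
  induction l with
  | zero => simpa using IsSingular.one n
  | succ l ih => rw [pow_succ]; exact ih.mul hp

/-- The singular vectors as a subspace. -/
def singularSubmodule (n : ℕ) : Submodule ℂ (SA n) where
  carrier := {p | IsSingular n p}
  zero_mem' := fun A _ => by simp [adAct]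
  add_mem' := fun {p q} hp hq A hA => by
    have : adAct n A (p + q) = adAct n A p + adAct n A q := by
      simp only [adAct, map_add, mul_add, Finset.sum_add_distrib]
    rw [this, hp A hA, hq A hA, add_zero]
  smul_mem' := fun c p hp A hA => by
    have : adAct n A (c • p) = c • adAct n A p := by
      simp only [adAct, Derivation.map_smul, mul_smul_comm, Finset.smul_sum]
    rw [this, hp A hA, smul_zero]

/-- The sign of the order-reversing permutation of `Fin k`. -/
def revSign (k : ℕ) : ℂ := ((Equiv.Perm.sign (Fin.revPerm : Equiv.Perm (Fin k)) : ℤ) : ℂ)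

theorem revSign_ne_zero (k : ℕ) : revSign k ≠ 0 := by
  rw [revSign]
  exact_mod_cast Units.ne_zero _

/-- The determinant of a matrix vanishing below the antidiagonal. -/
theorem det_of_antitriangular {k : ℕ} (T : Matrix (Fin k) (Fin k) ℂ)
    (hT : ∀ a b : Fin k, k ≤ (a : ℕ) + b → T a b = 0) :
    T.det = revSign k * ∏ a, T a (Fin.rev a) := by
  have h := Matrix.det_permute' (Fin.revPerm : Equiv.Perm (Fin k)) (T.submatrix id Fin.revPerm)
  rw [Matrix.submatrix_submatrix,
    Matrix.det_of_isUpperTriangular (M := T.submatrix id Fin.revPerm)] at h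
  · have h2 : T.submatrix (id ∘ id) (Fin.revPerm ∘ Fin.revPerm) = T := by
      ext a b
      simp
    rw [h2] at h
    simpa [revSign] using h
  · intro a b hab
    have hab : b < a := hab
    refine hT _ _ ?_
    have := Fin.lt_def.1 hab
    simp only [id, Fin.revPerm_apply, Fin.val_rev]
    omega

theorem det_corner_of_antitriangular {n k : ℕ} (hk : k ≤ n) (T : Matrix (Fin n) (Fin n) ℂ)
    (hT : ∀ i j : Fin n, n ≤ (i : ℕ) + j → T i j = 0) :
    (corner hk T).det = revSign k *
      ∏ a : Fin k, T ⟨a, by have := a.isLt; omega⟩ (Fin.rev ⟨a, by have := a.isLt; omega⟩) := by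
  rw [det_of_antitriangular]
  · congr 1
    refine Finset.prod_congr rfl fun a _ => ?_
    rw [corner, Matrix.of_apply]
    congr 1
    have := a.isLt
    simp only [Fin.ext_iff, Fin.val_rev]
    omega
  · intro a b hab
    exact hT _ _ (by simp only; omega)

/-- The antidiagonal matrix with given entries. -/
def antidiag {n : ℕ} (d : Fin n → ℂ) : Matrix (Fin n) (Fin n) ℂ :=
  Matrix.of fun i j => if j = Fin.rev i then d i else 0

theorem exists_row_operation {n : ℕ} (X : Matrix (Fin n) (Fin n) ℂ)
    (hX : ∀ k (hk : k ≤ n), (corner hk X).det ≠ 0) (i : Fin n) :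
    ∃ c : Fin n → ℂ, (∀ a, i ≤ a → c a = 0) ∧
      ∀ j : Fin n, n ≤ (i : ℕ) + j → X i j + ∑ a, c a * X a j = 0 := by
  have hi : (i : ℕ) ≤ n := i.isLt.le
  let K := corner hi X
  have hK : IsUnit K.det := isUnit_iff_ne_zero.2 (hX _ hi)
  let r : Fin (i : ℕ) → ℂ := fun b => - X i ⟨n - i + b, by have := b.isLt; omega⟩
  let c := Matrix.vecMul r K⁻¹
  have hc : Matrix.vecMul c K = r := by
    simp only [c, Matrix.vecMul_vecMul, Matrix.nonsing_inv_mul K hK, Matrix.vecMul_one]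
  refine ⟨fun a => if h : (a : ℕ) < i then c ⟨a, h⟩ else 0, fun a ha => ?_, fun j hj => ?_⟩
  · exact dif_neg (not_lt.2 (Fin.le_def.1 ha))
  · rw [sum_eq_sum_castLE hi]
    · have := congrFun hc ⟨(j : ℕ) - (n - i), by have := j.isLt; omega⟩
      simp only [Matrix.vecMul, dotProduct, r, K, corner, Matrix.of_apply] at this
      have hj' : n - (i : ℕ) + ((j : ℕ) - (n - i)) = j := by omega
      simp only [hj'] at this
      simp [this]
    · intro a ha
      exact mul_eq_zero_of_left (dif_neg (not_lt.2 ha)) _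

/-- A matrix with nonzero corner minors can be brought to antidiagonal form by the unipotent
group. -/
theorem exists_antidiag {n : ℕ} (X : Matrix (Fin n) (Fin n) ℂ)
    (hX : ∀ k (hk : k ≤ n), (corner hk X).det ≠ 0) :
    ∃ d : Fin n → ℂ,
      (∀ k (hk : k ≤ n), (corner hk X).det =
        revSign k * ∏ a : Fin k, d ⟨a, by have := a.isLt; omega⟩) ∧
      ∀ p, IsSingular n p → evalMat X p = evalMat (antidiag d) p := by
  choose c hc1 hc2 using exists_row_operation X hX
  let N : Matrix (Fin n) (Fin n) ℂ := Matrix.of c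
  have hN : IsStrictLower N := fun i j h => hc1 i j h
  have h0 : IsStrictLower (0 : Matrix (Fin n) (Fin n) ℂ) := fun _ _ _ => rfl
  let T := (1 + N) * X * (1 + 0)
  have hT : ∀ i j : Fin n, n ≤ (i : ℕ) + j → T i j = 0 := by
    intro i j hij
    rw [← hc2 i j hij]
    simp [T, N, add_mul, Matrix.mul_apply]
  let d : Fin n → ℂ := fun i => T i (Fin.rev i)
  have hdet : ∀ k (hk : k ≤ n), (corner hk X).det =
      revSign k * ∏ a : Fin k, d ⟨a, by have := a.isLt; omega⟩ := by
    intro k hk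
    rw [← det_corner_mul hk hN h0 X]
    exact det_corner_of_antitriangular hk T hT
  have hd : ∀ i, d i ≠ 0 := by
    have := hX n le_rfl
    rw [hdet n le_rfl] at this
    exact fun i => Finset.prod_ne_zero_iff.1 (right_ne_zero_of_mul this) i (Finset.mem_univ i)
  refine ⟨d, hdet, fun p hp => ?_⟩
  rw [← hp.evalMat_mul hN h0 X]
  change evalMat T p = _
  let M : Matrix (Fin n) (Fin n) ℂ :=
    Matrix.of fun a j => if a ≤ j then 0 else T (Fin.rev a) j / d (Fin.rev a)
  have hM : IsStrictLower M := fun i j h => if_pos h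
  rw [← hp.evalMat_mul h0 hM (antidiag d)]
  congr 1
  have : antidiag d * (1 + M) = T := by
    ext i j
    rw [Matrix.mul_apply, Finset.sum_eq_single (Fin.rev i)]
    · simp only [antidiag, Matrix.of_apply, if_true, Matrix.add_apply, M, Fin.rev_rev]
      rcases lt_trichotomy (Fin.rev i) j with h | h | h
      · rw [if_pos h.le, Matrix.one_apply_ne h.ne, hT i j, add_zero, mul_zero]
        have := Fin.lt_def.1 h
        simp only [Fin.val_rev] at this
        omega
      · subst h
        simp [d]
      · rw [if_neg (not_le.2 h), Matrix.one_apply_ne h.ne', zero_add, mul_div_cancel₀ _ (hd i)]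
    · intro a _ ha
      simp [antidiag, ha]
    · simp
  rw [add_zero, one_mul, this]

/-- On matrices with nonzero corner minors, a singular vector only depends on these minors. -/
theorem IsSingular.evalMat_eq_of_corner {n : ℕ} {p : SA n} (hp : IsSingular n p)
    {X Y : Matrix (Fin n) (Fin n) ℂ} (hX : ∀ k (hk : k ≤ n), (corner hk X).det ≠ 0)
    (hXY : ∀ k (hk : k ≤ n), (corner hk X).det = (corner hk Y).det) :
    evalMat X p = evalMat Y p := by
  obtain ⟨d, hd, hdp⟩ := exists_antidiag X hX
  obtain ⟨e, he, hep⟩ := exists_antidiag Y fun k hk => hXY k hk ▸ hX k hk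
  rw [hdp p hp, hep p hp]
  have hprod : ∀ k (hk : k ≤ n), ∏ a : Fin k, d ⟨a, by have := a.isLt; omega⟩ =
      ∏ a : Fin k, e ⟨a, by have := a.isLt; omega⟩ := by
    intro k hk
    have := hXY k hk
    rw [hd, he] at this
    exact mul_left_cancel₀ (revSign_ne_zero k) this
  have hde : d = e := by
    funext i
    have h1 := hprod (i + 1) i.isLt
    rw [Fin.prod_univ_castSucc, Fin.prod_univ_castSucc] at h1
    simp only [Fin.val_castSucc, Fin.val_last] at h1
    rw [hprod i i.isLt.le] at h1
    refine mul_left_cancel₀ ?_ h1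
    rw [← hprod i i.isLt.le]
    have := hX i i.isLt.le
    rw [hd] at this
    exact right_ne_zero_of_mul this
  rw [hde]

/-- A matrix, polynomial in `y`, whose corner minors are the `y k`. -/
def minorSection {n : ℕ} (y : Fin n → ℂ) : Matrix (Fin n) (Fin n) ℂ :=
  Matrix.of fun i j =>
    if (j : ℕ) + 1 = n then (revSign i)⁻¹ * y i else if (i : ℕ) + j + 2 = n then 1 else 0

theorem det_corner_minorSection {n : ℕ} (y : Fin n → ℂ) (k : Fin n) :
    (corner (Nat.succ_le_of_lt k.isLt) (minorSection y)).det = y k := by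
  have hk := k.isLt
  rw [Matrix.det_succ_row _ (Fin.last k), Finset.sum_eq_single (Fin.last (k : ℕ))]
  · have h1 : corner (Nat.succ_le_of_lt k.isLt) (minorSection y) (Fin.last k) (Fin.last k) =
        (revSign k)⁻¹ * y k := by
      rw [corner, Matrix.of_apply, minorSection, Matrix.of_apply, if_pos]
      · rfl
      · simp only [Fin.val_last]
        omega
    have h2 : ((corner (Nat.succ_le_of_lt k.isLt) (minorSection y)).submatrix
        (Fin.last (k : ℕ)).succAbove (Fin.last (k : ℕ)).succAbove).det = revSign k := by
      rw [det_of_antitriangular]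
      · rw [Finset.prod_eq_one, mul_one]
        intro a _
        have := a.isLt
        simp only [Matrix.submatrix_apply, Fin.succAbove_last, corner, minorSection,
          Matrix.of_apply, Fin.val_castSucc, Fin.val_rev]
        rw [if_neg (by omega), if_pos (by omega)]
      · intro a b hab
        have := a.isLt
        have := b.isLt
        simp only [Matrix.submatrix_apply, Fin.succAbove_last, corner, minorSection,
          Matrix.of_apply, Fin.val_castSucc]
        rw [if_neg (by omega), if_neg (by omega)]
    rw [h1, h2]
    have := revSign_ne_zero k
    simp only [Fin.val_last, ← two_mul, pow_mul, neg_one_sq, one_pow, one_mul]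
    field_simp
  · intro b _ hb
    have hb' : (b : ℕ) ≠ k := fun h => hb (Fin.ext h)
    have := b.isLt
    have h0 : corner (Nat.succ_le_of_lt k.isLt) (minorSection y) (Fin.last k) b = 0 := by
      simp only [corner, minorSection, Matrix.of_apply, Fin.val_last]
      rw [if_neg (by omega), if_neg (by omega)]
    rw [h0, mul_zero, zero_mul]
  · simp

theorem prod_DetP_ne_zero (n : ℕ) :
    ∏ k : Fin n, DetP n ((k : ℕ) + 1) k.isLt ≠ 0 := by
  refine Finset.prod_ne_zero_iff.2 fun k _ h => ?_
  have := det_corner_minorSection (fun _ => 1) k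
  rw [← evalMat_DetP, h, map_zero] at this
  exact zero_ne_one this

/-- A singular vector is a polynomial in the corner minors. -/
theorem IsSingular.exists_aeval {n : ℕ} {p : SA n} (hp : IsSingular n p) :
    ∃ Q : MvPolynomial (Fin n) ℂ,
      p = MvPolynomial.aeval (fun k : Fin n => DetP n ((k : ℕ) + 1) k.isLt) Q := by
  let s : Fin n × Fin n → MvPolynomial (Fin n) ℂ := fun v =>
    if (v.2 : ℕ) + 1 = n then MvPolynomial.C (revSign v.1)⁻¹ * MvPolynomial.X v.1
    else if (v.1 : ℕ) + v.2 + 2 = n then 1 else 0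
  have hs : ∀ (y : Fin n → ℂ) (q : SA n),
      MvPolynomial.eval y (MvPolynomial.aeval s q) = evalMat (minorSection y) q := by
    intro y q
    induction q using MvPolynomial.induction_on with
    | C a => simp [evalMat]
    | add q r hq hr => simp only [map_add, hq, hr]
    | mul_X q v hq =>
      simp only [map_mul, hq, MvPolynomial.aeval_X]
      congr 1
      simp only [s, evalMat, MvPolynomial.eval_X, minorSection, Matrix.of_apply]
      split_ifs <;> simp
  refine ⟨MvPolynomial.aeval s p, ?_⟩
  refine mul_right_cancel₀ (prod_DetP_ne_zero n) (MvPolynomial.funext fun x => ?_)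
  let X : Matrix (Fin n) (Fin n) ℂ := Matrix.of fun i j => x (i, j)
  change evalMat X _ = evalMat X _
  rw [map_mul, map_mul, map_prod]
  by_cases h : ∀ k : Fin n, evalMat X (DetP n ((k : ℕ) + 1) k.isLt) ≠ 0
  · congr 1
    have hcomp : ∀ Q : MvPolynomial (Fin n) ℂ,
        evalMat X (MvPolynomial.aeval (fun k : Fin n => DetP n ((k : ℕ) + 1) k.isLt) Q) =
          MvPolynomial.eval (fun k : Fin n => evalMat X (DetP n ((k : ℕ) + 1) k.isLt)) Q := by
      intro Q
      induction Q using MvPolynomial.induction_on with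
      | C a => simp [evalMat]
      | add q r hq hr => simp only [map_add, hq, hr]
      | mul_X q v hq => simp only [map_mul, hq, MvPolynomial.aeval_X, MvPolynomial.eval_X]
    rw [hcomp, hs]
    refine hp.evalMat_eq_of_corner (fun k hk => ?_) fun k hk => ?_
    · cases k with
      | zero => simp
      | succ k => rw [← evalMat_DetP]; exact h ⟨k, hk⟩
    · cases k with
      | zero => simp
      | succ k => rw [det_corner_minorSection _ ⟨k, hk⟩, evalMat_DetP]
  · push Not at h
    obtain ⟨k, hk⟩ := h
    rw [Finset.prod_eq_zero (Finset.mem_univ k) hk, mul_zero, mul_zero]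

/-- An element of `S(a₋)` is a singular vector if and only if it is a linear combination of
the monomials `Det_1^{l_1} ⋯ Det_n^{l_n}` with `l_i ∈ ℕ`. -/
theorem singular_iff_span_det_monomials (n : ℕ) (hn : 1 ≤ n) (p : SA n) :
    IsSingular n p ↔
      p ∈ Submodule.span ℂ
        {q : SA n | ∃ l : Fin n → ℕ,
          q = ∏ k : Fin n, (DetP n ((k : ℕ) + 1) k.isLt) ^ l k} := by
  constructor
  · intro hp
    obtain ⟨Q, rfl⟩ := hp.exists_aeval
    rw [MvPolynomial.aeval_def, MvPolynomial.eval₂_eq']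
    refine Submodule.sum_mem _ fun m _ => ?_
    rw [← Algebra.smul_def]
    exact Submodule.smul_mem _ _ (Submodule.subset_span ⟨m, rfl⟩)
  · intro hp
    have : Submodule.span ℂ {q : SA n | ∃ l : Fin n → ℕ,
        q = ∏ k : Fin n, (DetP n ((k : ℕ) + 1) k.isLt) ^ l k} ≤ singularSubmodule n := by
      refine Submodule.span_le.2 ?_
      rintro q ⟨l, rfl⟩
      exact Finset.prod_induction _ (IsSingular n) (fun _ _ => IsSingular.mul) (IsSingular.one n)
        fun k _ => (isSingular_DetP k.isLt).pow (l k)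
    exact this hp

end
end

section
/- Let λ₋, μ₊ and ν be fixed dominant integral weights for gl_N with N sufficiently large, where ν = (ν_1,...,ν_k, 0,...,0, ν_s,...,ν_N) has ν_1 ≥ ... ≥ ν_k > 0 and 0 > ν_s ≥ ... ≥ ν_N, λ₋ is a weight with all entries ≤ 0 and μ₊ a weight with all entries ≥ 0. Then the Littlewood–Richardson-type identity holds: Σ_D c^{λ₋}_{Λ₋(ν), D₋} · c^{μ₊}_{Λ₊(ν), D₊} = c^{ν}_{λ₋, μ₊}, where the sum runs over all partitions D = (l_1, l_2, ..., l_n, ...) (finitely supported sequences of nonnegative integers), D₋ is the dominant weight (..., 0, -l_n, ..., -(l_2+...+l_n), -(l_1+...+l_n)) supported on the last coordinates, D₊ is the dominant weight (l_1+...+l_n, l_2+...+l_n, ..., l_n, 0, ...) supported on the first coordinates, Λ₋(ν) = (0,...,0,ν_s,...,ν_N) and Λ₊(ν) = (ν_1,...,ν_k,0,...,0), and c^γ_{α,β} denotes the multiplicity of the irreducible gl_N-module L(γ) in L(α) ⊗ L(β). Both sides are finite and independent of N for N large. -/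
/-
STATEMENT 10: The "reciprocity formula" for Clebsch–Gordan coefficients:
Σ_D c^{λ₋}_{Λ₋(ν), D₋} · c^{μ₊}_{Λ₊(ν), D₊} = c^{ν}_{λ₋, μ₊}  for gl_N with N large.
Characters of irreducible gl_N-modules are elements s(α) of the group algebra
ℂ[ℤ^N] (Laurent polynomials), characterized by the Weyl character formula
a(δ) · s(α) = a(α + δ), where a(w) = Σ_σ sgn(σ) x^{w∘σ} and δ = (N-1, …, 1, 0).
Clebsch–Gordan coefficients cg(α, β, γ) are characterized by
s(α)·s(β) = Σ_γ cg(α,β,γ) s(γ), the sum over dominant γ (finitely many nonzero).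
Young diagrams D are finitely supported sequences l : ℕ →₀ ℕ (l i = l_{i+1} of the
paper), with D₊ = (Σ_{i≥0} l i, Σ_{i≥1} l i, …) at the front and
D₋ = (…, -Σ_{i≥1} l i, -Σ_{i≥0} l i) at the back.
-/

noncomputable section

/-- The alternating sum `a(w) = Σ_{σ ∈ S_N} sgn(σ) · x^{w ∘ σ}` in the group algebra
`ℂ[ℤ^N]`. -/
def aalt (N : ℕ) (w : Fin N → ℤ) : AddMonoidAlgebra ℂ (Fin N → ℤ) :=
  ∑ σ : Equiv.Perm (Fin N),
    ((Equiv.Perm.sign σ : ℤ) : ℂ) • AddMonoidAlgebra.single (w ∘ σ) 1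

/-- `δ = (N-1, N-2, …, 1, 0)`. -/
def δwt (N : ℕ) : Fin N → ℤ := fun i => (N : ℤ) - 1 - (i : ℤ)

/-- Padding a finite tuple by zeros, as a function on ℕ. -/
def padF {r : ℕ} (f : Fin r → ℤ) : ℕ → ℤ :=
  fun j => if h : j < r then f ⟨j, h⟩ else 0

/-- `f` placed in the first coordinates of a gl_N-weight. -/
def frontPad {r : ℕ} (f : Fin r → ℤ) (N : ℕ) : Fin N → ℤ := fun i => padF f i

/-- `g` placed in the last `r` coordinates of a gl_N-weight. -/
def backPad {r : ℕ} (g : Fin r → ℤ) (N : ℕ) : Fin N → ℤ :=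
  fun i => if N - r ≤ (i : ℕ) then padF g ((i : ℕ) - (N - r)) else 0

/-- The `j`-th partial sum `l_{j+1} + l_{j+2} + …` of a Young diagram `l`. -/
def tailSum (l : ℕ →₀ ℕ) (j : ℕ) : ℤ :=
  ∑ i ∈ l.support, if j ≤ (i : ℕ) then (l i : ℤ) else 0

/-- `D₊ = (l_1 + l_2 + …, l_2 + l_3 + …, …)` at the front. -/
def Dplus (l : ℕ →₀ ℕ) (N : ℕ) : Fin N → ℤ := fun i => tailSum l (i : ℕ)

/-- `D₋ = (…, 0, -l_n, …, -(l_1 + … + l_n))` at the back. -/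
def Dminus (l : ℕ →₀ ℕ) (N : ℕ) : Fin N → ℤ := fun i => -(tailSum l (N - 1 - (i : ℕ)))

theorem coeff_aalt (N : ℕ) (w v : Fin N → ℤ) :
    (aalt N w).coeff v =
      ∑ σ : Equiv.Perm (Fin N), ((Equiv.Perm.sign σ : ℤ) : ℂ) * if w ∘ σ = v then 1 else 0 := by
  simp [aalt, Finsupp.finsetSum_apply, Finsupp.single_apply]

theorem coeff_aalt_mul (N : ℕ) (w v : Fin N → ℤ) (f : AddMonoidAlgebra ℂ (Fin N → ℤ)) :
    (aalt N w * f).coeff v =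
      ∑ σ : Equiv.Perm (Fin N), ((Equiv.Perm.sign σ : ℤ) : ℂ) * f.coeff (v - w ∘ σ) := by
  simp [aalt, Finset.sum_mul, Finsupp.finsetSum_apply, neg_add_eq_sub]

theorem coeff_aalt_comm (N : ℕ) (w v : Fin N → ℤ) :
    (aalt N w).coeff v = (aalt N v).coeff w := by
  rw [coeff_aalt, coeff_aalt]
  refine Fintype.sum_equiv (Equiv.inv _) _ _ fun σ => ?_
  have : (w ∘ σ = v) ↔ (v ∘ ⇑(σ⁻¹) = w) := by
    constructor
    · rintro rfl; ext i; simp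
    · rintro rfl; ext i; simp
  simp [this]

theorem StrictAnti.comp_perm_eq {N : ℕ} {u v : Fin N → ℤ} (hu : StrictAnti u) (hv : StrictAnti v)
    {σ : Equiv.Perm (Fin N)} (h : u ∘ σ = v) : σ = 1 := by
  have hσ : StrictMono σ := fun i j hij => by
    have := hv hij
    rw [← h] at this
    exact hu.lt_iff_gt.1 this
  ext i
  have := Subsingleton.elim (hσ.orderIsoOfSurjective _ σ.surjective) (OrderIso.refl _)
  exact congrArg Fin.val (DFunLike.congr_fun this i)

theorem coeff_aalt_of_strictAnti {N : ℕ} {u v : Fin N → ℤ} (hu : StrictAnti u)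
    (hv : StrictAnti v) : (aalt N u).coeff v = if u = v then 1 else 0 := by
  rw [coeff_aalt, Finset.sum_eq_single 1]
  · simp
  · intro σ _ hσ
    rw [if_neg fun h => hσ (hu.comp_perm_eq hv h), mul_zero]
  · simp

theorem δwt_strictAnti (N : ℕ) : StrictAnti (δwt N) := fun i j hij => by
  simp only [δwt]
  have : (i : ℕ) < j := hij
  omega

theorem δwt_nonneg (N : ℕ) (i : Fin N) : 0 ≤ δwt N i := by
  simp only [δwt]; omega

theorem Antitone.add_δwt {N : ℕ} {α : Fin N → ℤ} (h : Antitone α) : StrictAnti (α + δwt N) :=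
  h.add_strictAnti (δwt_strictAnti N)

theorem StrictAnti.antitone_sub_δwt {N : ℕ} {u : Fin N → ℤ} (h : StrictAnti u) :
    Antitone (u - δwt N) := by
  cases N with
  | zero => exact fun i => i.elim0
  | succ N =>
    refine Fin.antitone_iff_succ_le.2 fun i => ?_
    have := h (Fin.castSucc_lt_succ (i := i))
    simp [δwt] at *
    omega

theorem StrictAnti.nonneg_sub_δwt {N : ℕ} {u : Fin N → ℤ} (h : StrictAnti u) (h0 : 0 ≤ u) :
    0 ≤ u - δwt N := by
  intro i
  have hN := i.pos
  have h1 := h.antitone_sub_δwt (a := i) (b := ⟨N - 1, by omega⟩) (Fin.le_def.2 (by simp; omega))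
  have h2 := h0 ⟨N - 1, by omega⟩
  refine le_trans ?_ h1
  simp [δwt] at *
  omega

theorem aalt_δwt_ne_zero (N : ℕ) : aalt N (δwt N) ≠ 0 := by
  intro h
  have := coeff_aalt_of_strictAnti (δwt_strictAnti N) (δwt_strictAnti N)
  simp [h] at this

theorem aalt_δwt_cancel {N : ℕ} {f g : AddMonoidAlgebra ℂ (Fin N → ℤ)}
    (h : aalt N (δwt N) * f = aalt N (δwt N) * g) : f = g :=
  mul_left_cancel₀ (aalt_δwt_ne_zero N) h

/-- `f` is a homogeneous polynomial of degree `m`: all its exponents are nonnegative with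
sum `m`. -/
def PolyHomog {N : ℕ} (m : ℤ) (f : AddMonoidAlgebra ℂ (Fin N → ℤ)) : Prop :=
  ∀ v, f.coeff v ≠ 0 → 0 ≤ v ∧ ∑ i, v i = m

namespace PolyHomog

variable {N : ℕ} {m n : ℤ} {f g : AddMonoidAlgebra ℂ (Fin N → ℤ)}

theorem mul (hf : PolyHomog m f) (hg : PolyHomog n g) : PolyHomog (m + n) (f * g) := by
  intro v hv
  have := AddMonoidAlgebra.support_coeff_mul_subset f g (Finsupp.mem_support_iff.2 hv)
  obtain ⟨a, ha, b, hb, rfl⟩ := Finset.mem_add.1 this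
  obtain ⟨ha1, ha2⟩ := hf a (Finsupp.mem_support_iff.1 ha)
  obtain ⟨hb1, hb2⟩ := hg b (Finsupp.mem_support_iff.1 hb)
  exact ⟨add_nonneg ha1 hb1, by simp [Finset.sum_add_distrib, ha2, hb2]⟩

theorem single (v : Fin N → ℤ) (hv : 0 ≤ v) (c : ℂ) :
    PolyHomog (∑ i, v i) (AddMonoidAlgebra.single v c) := by
  intro w hw
  rw [AddMonoidAlgebra.coeff_single, Finsupp.single_apply] at hw
  have : v = w := by by_contra h; simp [h] at hw
  subst this
  exact ⟨hv, rfl⟩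

theorem one : PolyHomog 0 (1 : AddMonoidAlgebra ℂ (Fin N → ℤ)) := by
  have := PolyHomog.single (0 : Fin N → ℤ) le_rfl 1
  simpa [AddMonoidAlgebra.one_def] using this

theorem zero : PolyHomog m (0 : AddMonoidAlgebra ℂ (Fin N → ℤ)) := fun v hv => by simp at hv

theorem sum {ι : Type*} (s : Finset ι) (F : ι → AddMonoidAlgebra ℂ (Fin N → ℤ))
    (h : ∀ i ∈ s, PolyHomog m (F i)) : PolyHomog m (∑ i ∈ s, F i) := by
  intro v hv
  rw [AddMonoidAlgebra.coeff_sum, Finsupp.finsetSum_apply] at hv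
  obtain ⟨i, hi, hne⟩ := Finset.exists_ne_zero_of_sum_ne_zero hv
  exact h i hi v hne

theorem smul (hf : PolyHomog m f) (c : ℂ) : PolyHomog m (c • f) := by
  intro v hv
  refine hf v fun h => hv ?_
  simp [h]

theorem prod {ι : Type*} (s : Finset ι) (F : ι → AddMonoidAlgebra ℂ (Fin N → ℤ)) (d : ι → ℤ)
    (h : ∀ i ∈ s, PolyHomog (d i) (F i)) : PolyHomog (∑ i ∈ s, d i) (∏ i ∈ s, F i) := by
  classical
  induction s using Finset.induction_on with
  | empty => simpa using one
  | insert a s ha ih =>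
    rw [Finset.sum_insert ha, Finset.prod_insert ha]
    exact (h a (by simp)).mul (ih fun i hi => h i (by simp [hi]))

theorem aalt (w : Fin N → ℤ) (hw : 0 ≤ w) : PolyHomog (∑ i, w i) (aalt N w) := by
  refine sum _ _ fun σ _ => smul ?_ _
  have := PolyHomog.single (w ∘ σ) (fun i => hw (σ i)) 1
  rwa [show ∑ i, (w ∘ σ) i = ∑ i, w i from Equiv.sum_comp σ w] at this

end PolyHomog

/-- The generating series `∏ j, ∑ n, x_j ^ n T ^ n` of the complete homogeneous symmetric
polynomials. -/
def hSeries (N : ℕ) : PowerSeries (AddMonoidAlgebra ℂ (Fin N → ℤ)) :=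
  ∏ j : Fin N, PowerSeries.mk fun n => AddMonoidAlgebra.single (Pi.single j (n : ℤ)) 1

/-- The complete homogeneous symmetric polynomial of degree `m`, zero for negative `m`. -/
def hsym (N : ℕ) (m : ℤ) : AddMonoidAlgebra ℂ (Fin N → ℤ) :=
  if 0 ≤ m then PowerSeries.coeff m.toNat (hSeries N) else 0

theorem hsym_of_neg (N : ℕ) {m : ℤ} (hm : m < 0) : hsym N m = 0 := if_neg (by omega)

theorem hsym_natCast (N n : ℕ) : hsym N n = PowerSeries.coeff n (hSeries N) := by
  simp [hsym]

theorem hsym_zero (N : ℕ) : hsym N 0 = 1 := by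
  have := hsym_natCast N 0
  simpa [hSeries, map_prod, AddMonoidAlgebra.one_def] using this

theorem polyHomog_hsym (N : ℕ) (m : ℤ) : PolyHomog m (hsym N m) := by
  rcases lt_or_ge m 0 with hm | hm
  · rw [hsym_of_neg N hm]; exact PolyHomog.zero
  lift m to ℕ using hm
  rw [hsym_natCast, hSeries, PowerSeries.coeff_prod]
  refine PolyHomog.sum _ _ fun l hl => ?_
  have hl' := (Finset.mem_finsuppAntidiag.1 hl).1
  rw [← hl', Nat.cast_sum]
  refine PolyHomog.prod _ _ _ fun i _ => ?_
  rw [PowerSeries.coeff_mk]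
  have := PolyHomog.single (Pi.single i (l i : ℤ) : Fin N → ℤ)
    (Pi.single_nonneg.2 (by positivity)) 1
  simpa using this

/-- The generating polynomial `∏_{i ≠ j} (1 - x_i T)`. -/
def eSeries (N : ℕ) (j : Fin N) : Polynomial (AddMonoidAlgebra ℂ (Fin N → ℤ)) :=
  ∏ i ∈ Finset.univ.erase j,
    (1 - Polynomial.C (AddMonoidAlgebra.single (Pi.single i 1) 1) * Polynomial.X)

theorem natDegree_eSeries_lt (N : ℕ) (j : Fin N) : (eSeries N j).natDegree < N := by
  have h : (eSeries N j).natDegree ≤ ∑ i ∈ Finset.univ.erase j, 1 := by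
    refine (Polynomial.natDegree_prod_le _ _).trans (Finset.sum_le_sum fun i _ => ?_)
    compute_degree
  have := j.pos
  simp at h
  omega

theorem mk_mul_one_sub {R : Type*} [CommRing R] (x : R) :
    (PowerSeries.mk fun n => x ^ n) * (1 - PowerSeries.C x * PowerSeries.X) = 1 := by
  ext n
  rw [mul_sub, mul_one, ← mul_assoc, mul_comm _ (PowerSeries.C x), map_sub]
  cases n with
  | zero => simp
  | succ n =>
    rw [PowerSeries.coeff_succ_mul_X, PowerSeries.coeff_C_mul]
    simp [PowerSeries.coeff_one, pow_succ']

theorem single_pi_pow {N : ℕ} (j : Fin N) (n : ℕ) :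
    (AddMonoidAlgebra.single (Pi.single j (n : ℤ)) 1 : AddMonoidAlgebra ℂ (Fin N → ℤ)) =
      AddMonoidAlgebra.single (Pi.single j 1) 1 ^ n := by
  rw [AddMonoidAlgebra.single_pow, one_pow, ← Pi.single_smul]
  simp

theorem hSeries_mul_eSeries (N : ℕ) (j : Fin N) :
    hSeries N * (eSeries N j : PowerSeries _) =
      PowerSeries.mk fun n => AddMonoidAlgebra.single (Pi.single j (n : ℤ)) 1 := by
  have he : (eSeries N j : PowerSeries (AddMonoidAlgebra ℂ (Fin N → ℤ))) =
      ∏ i ∈ Finset.univ.erase j,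
        (1 - PowerSeries.C (AddMonoidAlgebra.single (Pi.single i 1) 1) * PowerSeries.X) := by
    rw [eSeries, ← Polynomial.coeToPowerSeries.ringHom_apply, map_prod]
    simp
  rw [hSeries, ← Finset.mul_prod_erase _ _ (Finset.mem_univ j), he, mul_assoc,
    ← Finset.prod_mul_distrib, Finset.prod_eq_one, mul_one]
  intro i _
  simp_rw [single_pi_pow]
  exact mk_mul_one_sub _

theorem sum_hsym_mul_eSeries (N : ℕ) (j : Fin N) {m : ℤ} (hm : 0 ≤ m) :
    ∑ k : Fin N, hsym N (m - δwt N k) * (eSeries N j).coeff (δwt N k).toNat =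
      AddMonoidAlgebra.single (Pi.single j m) 1 := by
  lift m to ℕ using hm
  have h := congrArg (PowerSeries.coeff m) (hSeries_mul_eSeries N j)
  rw [PowerSeries.coeff_mk, PowerSeries.coeff_mul,
    ← Finset.Nat.sum_antidiagonal_swap, Finset.Nat.sum_antidiagonal_eq_sum_range_succ_mk] at h
  have hδ (k : Fin N) : δwt N (Fin.revPerm k) = (k : ℕ) := by
    simp [δwt, Fin.val_rev]
  rw [← h, ← Equiv.sum_comp Fin.revPerm]
  simp only [Prod.fst_swap, Prod.snd_swap, Polynomial.coeff_coe, hδ, Int.toNat_natCast]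
  rw [Fin.sum_univ_eq_sum_range
    (fun q : ℕ => hsym N ((m : ℤ) - q) * (eSeries N j).coeff q) N,
    Finset.sum_subset (Finset.range_mono (Nat.le_max_right (m + 1) N))]
  · rw [← Finset.sum_subset (Finset.range_mono (Nat.le_max_left (m + 1) N))]
    · refine Finset.sum_congr rfl fun q hq => ?_
      have : q ≤ m := Nat.lt_succ_iff.1 (Finset.mem_range.1 hq)
      rw [← Nat.cast_sub this, hsym_natCast]
    · intro q _ hq
      rw [hsym_of_neg, zero_mul]
      simp at hq
      omega
  · intro q _ hq
    rw [Polynomial.coeff_eq_zero_of_natDegree_lt, mul_zero]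
    have := natDegree_eSeries_lt N j
    simp at hq
    omega

/-- The Jacobi–Trudi matrix with entries `h_{u_i - v_j}`. -/
def jacobiTrudi (N : ℕ) (u v : Fin N → ℤ) :
    Matrix (Fin N) (Fin N) (AddMonoidAlgebra ℂ (Fin N → ℤ)) :=
  Matrix.of fun i j => hsym N (u i - v j)

theorem det_jacobiTrudi (N : ℕ) (u v : Fin N → ℤ) :
    (jacobiTrudi N u v).det = ∑ σ : Equiv.Perm (Fin N),
      ((Equiv.Perm.sign σ : ℤ) : ℂ) • ∏ i, hsym N (u i - v (σ i)) := by
  rw [← Matrix.det_transpose, Matrix.det_apply]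
  refine Finset.sum_congr rfl fun σ _ => ?_
  rw [Units.smul_def, Int.cast_smul_eq_zsmul]
  rfl

theorem det_hsym_sub_of_strictAnti {N : ℕ} {m : Type*} [Fintype m] [LinearOrder m] (d : m → ℤ)
    (hd : StrictAnti d) : (Matrix.of fun i j => hsym N (d i - d j)).det = 1 := by
  rw [Matrix.det_of_isUpperTriangular]
  · simp [hsym_zero]
  · intro i j hij
    exact hsym_of_neg N (sub_neg.2 (hd hij))

theorem single_eq_prod {N : ℕ} (w : Fin N → ℤ) :
    (AddMonoidAlgebra.single w 1 : AddMonoidAlgebra ℂ (Fin N → ℤ)) =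
      ∏ i, AddMonoidAlgebra.single (Pi.single i (w i)) 1 := by
  rw [AddMonoidAlgebra.prod_single, Finset.univ_sum_single]
  simp

theorem aalt_eq_det (N : ℕ) (w : Fin N → ℤ) :
    aalt N w = (Matrix.of fun i j : Fin N =>
      (AddMonoidAlgebra.single (Pi.single j (w i)) 1 : AddMonoidAlgebra ℂ (Fin N → ℤ))).det := by
  rw [Matrix.det_apply, aalt]
  refine Finset.sum_congr rfl fun σ _ => ?_
  rw [Units.smul_def, Int.cast_smul_eq_zsmul, single_eq_prod]
  rfl

/-- The Jacobi–Trudi identity. -/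
theorem aalt_mul_det_jacobiTrudi (N : ℕ) (w : Fin N → ℤ) (hw : 0 ≤ w) :
    aalt N (δwt N) * (jacobiTrudi N w (δwt N)).det = aalt N w := by
  have key (u : Fin N → ℤ) (hu : 0 ≤ u) : aalt N u = (jacobiTrudi N u (δwt N)).det *
      (Matrix.of fun k j : Fin N => (eSeries N j).coeff (δwt N k).toNat).det := by
    rw [aalt_eq_det, ← Matrix.det_mul]
    congr 1
    ext1 i j
    simp only [Matrix.mul_apply, jacobiTrudi, Matrix.of_apply]
    exact (sum_hsym_mul_eSeries N j (hu i)).symm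
  rw [key w hw, key _ (δwt_nonneg N), jacobiTrudi,
    det_hsym_sub_of_strictAnti _ (δwt_strictAnti N), one_mul, mul_comm]

theorem det_jacobiTrudi_eq_zero {N : ℕ} {w : Fin N → ℤ} (hw : ¬ 0 ≤ w) :
    (jacobiTrudi N w (δwt N)).det = 0 := by
  obtain ⟨i, hi⟩ : ∃ i, w i < 0 := by simpa [Pi.le_def] using hw
  refine Matrix.det_eq_zero_of_row_eq_zero i fun j => hsym_of_neg N ?_
  have := δwt_nonneg N j
  omega

theorem polyHomog_prod_hsym (N : ℕ) (w : Fin N → ℤ) :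
    PolyHomog (∑ i, w i) (∏ i, hsym N (w i)) :=
  PolyHomog.prod _ _ _ fun i _ => polyHomog_hsym N (w i)

theorem polyHomog_det_jacobiTrudi (N : ℕ) (u v : Fin N → ℤ) :
    PolyHomog (∑ i, u i - ∑ i, v i) (jacobiTrudi N u v).det := by
  rw [det_jacobiTrudi]
  refine PolyHomog.sum _ _ fun σ _ => PolyHomog.smul ?_ _
  have := polyHomog_prod_hsym N (u - v ∘ σ)
  rwa [show ∑ i, (u - v ∘ σ) i = ∑ i, u i - ∑ i, v i by
    simp [Finset.sum_sub_distrib, Equiv.sum_comp σ v]] at this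

/-- The multiplicity of the weight `w` in the polynomial representation of highest weight `μ`
is the coefficient of `s_μ` in `h_w`. -/
theorem coeff_character_eq {N : ℕ} {μ : Fin N → ℤ} (hμ : 0 ≤ μ)
    {χ : AddMonoidAlgebra ℂ (Fin N → ℤ)}
    (hχ : aalt N (δwt N) * χ = aalt N (μ + δwt N)) (w : Fin N → ℤ) :
    χ.coeff w = (aalt N (δwt N) * ∏ i, hsym N (w i)).coeff (μ + δwt N) := by
  set F : (Fin N → ℤ) → ℂ :=
    fun w => (aalt N (δwt N) * ∏ i, hsym N (w i)).coeff (μ + δwt N) with hF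
  have hμδ : 0 ≤ μ + δwt N := add_nonneg hμ (δwt_nonneg N)
  have hsupp (w : Fin N → ℤ) (h : F w ≠ 0) : w ∈ Set.Icc 0 (fun _ => ∑ i, μ i) := by
    have h0 : 0 ≤ w := by
      intro i
      by_contra hi
      refine h ?_
      rw [hF]
      simp only
      rw [Finset.prod_eq_zero (Finset.mem_univ i) (hsym_of_neg N (not_le.1 hi))]
      simp
    have h1 := ((PolyHomog.aalt _ (δwt_nonneg N)).mul (polyHomog_prod_hsym N w) _ h).2
    simp only [Pi.add_apply, Finset.sum_add_distrib] at h1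
    refine ⟨h0, fun i => ?_⟩
    have := Finset.single_le_sum (f := w) (fun j _ => h0 j) (Finset.mem_univ i)
    simp only
    omega
  have hfin : (Function.support F).Finite := (Set.finite_Icc _ _).subset hsupp
  suffices h : χ = AddMonoidAlgebra.ofCoeff (Finsupp.ofSupportFinite F hfin) by
    rw [h]; rfl
  refine aalt_δwt_cancel (hχ.trans ?_)
  ext v
  rw [coeff_aalt_mul, coeff_aalt_comm]
  have h1 : (aalt N (δwt N) * (jacobiTrudi N v (δwt N)).det).coeff (μ + δwt N) =
      (aalt N v).coeff (μ + δwt N) := by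
    by_cases hv : 0 ≤ v
    · rw [aalt_mul_det_jacobiTrudi N v hv]
    · rw [det_jacobiTrudi_eq_zero hv, mul_zero, coeff_aalt]
      refine (Finset.sum_eq_zero fun σ _ => ?_).symm
      rw [if_neg, mul_zero]
      intro h
      refine hv fun i => ?_
      have := hμδ (σ.symm i)
      rw [← h] at this
      simpa using this
  rw [← h1, det_jacobiTrudi, Finset.mul_sum, AddMonoidAlgebra.coeff_sum,
    Finsupp.finsetSum_apply]
  refine Finset.sum_congr rfl fun σ _ => ?_
  rw [mul_smul_comm, AddMonoidAlgebra.coeff_smul, Finsupp.smul_apply, smul_eq_mul]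
  rfl

theorem coeff_aalt_mul_det_jacobiTrudi {N : ℕ} {μ : Fin N → ℤ} (hμ : 0 ≤ μ)
    {χ : AddMonoidAlgebra ℂ (Fin N → ℤ)}
    (hχ : aalt N (δwt N) * χ = aalt N (μ + δwt N)) (u v : Fin N → ℤ) :
    (aalt N (δwt N) * (jacobiTrudi N u v).det).coeff (μ + δwt N) = (aalt N v * χ).coeff u := by
  rw [det_jacobiTrudi, Finset.mul_sum, AddMonoidAlgebra.coeff_sum, Finsupp.finsetSum_apply,
    coeff_aalt_mul]
  refine Finset.sum_congr rfl fun σ _ => ?_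
  rw [mul_smul_comm, AddMonoidAlgebra.coeff_smul, Finsupp.smul_apply, smul_eq_mul,
    coeff_character_eq hμ hχ]
  rfl

theorem det_jacobiTrudi_add {N : ℕ} (n : ℕ) (μ p q : Fin N → ℤ)
    (hμ : ∀ i : Fin N, n ≤ i → μ i = 0) (hp : ∀ i : Fin N, n ≤ i → p i = 0) (hp0 : 0 ≤ p)
    (hq : ∀ i : Fin N, i < n → q i = 0) :
    (jacobiTrudi N (μ + δwt N) (p + q + δwt N)).det =
      (jacobiTrudi N (μ + δwt N) (p + δwt N)).det *
        (jacobiTrudi N (δwt N) (q + δwt N)).det := by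
  have hlt {i j : Fin N} (hi : ¬ (i : ℕ) < n) (hj : (j : ℕ) < n) : δwt N i < δwt N j :=
    δwt_strictAnti N (Fin.lt_def.2 (by omega))
  rw [Matrix.twoBlockTriangular_det (jacobiTrudi N (μ + δwt N) (p + q + δwt N))
      (fun i => (i : ℕ) < n),
    Matrix.twoBlockTriangular_det (jacobiTrudi N (μ + δwt N) (p + δwt N))
      (fun i => (i : ℕ) < n),
    Matrix.twoBlockTriangular_det (jacobiTrudi N (δwt N) (q + δwt N)) (fun i => (i : ℕ) < n)]
  · have h1 : (Matrix.toSquareBlockProp (jacobiTrudi N (δwt N) (q + δwt N))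
        fun i => (i : ℕ) < n).det = 1 := by
      rw [← det_hsym_sub_of_strictAnti (N := N) (fun i : {i : Fin N // (i : ℕ) < n} => δwt N i)
        fun _ _ h => δwt_strictAnti N h]
      congr 1
      ext1 i j
      simp [jacobiTrudi, Matrix.toSquareBlockProp, hq _ j.2]
    have h2 : (Matrix.toSquareBlockProp (jacobiTrudi N (μ + δwt N) (p + δwt N))
        fun i => ¬ (i : ℕ) < n).det = 1 := by
      rw [← det_hsym_sub_of_strictAnti (N := N)
        (fun i : {i : Fin N // ¬ (i : ℕ) < n} => δwt N i) fun _ _ h => δwt_strictAnti N h]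
      congr 1
      ext1 i j
      simp [jacobiTrudi, Matrix.toSquareBlockProp, hp _ (not_lt.1 j.2), hμ _ (not_lt.1 i.2)]
    rw [h1, h2, mul_one, one_mul]
    congr 2
    · ext1 i j
      simp [jacobiTrudi, Matrix.toSquareBlockProp, hq _ j.2]
    · ext1 i j
      simp [jacobiTrudi, Matrix.toSquareBlockProp, hp _ (not_lt.1 j.2), hμ _ (not_lt.1 i.2)]
  all_goals
    intro i hi j hj
    refine hsym_of_neg N ?_
    have h1 := hlt hi hj
    have h2 := hp0 j
    have h3 := hq j hj
    have h4 := hμ i (not_lt.1 hi)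
    simp only [Pi.add_apply, Pi.zero_apply] at *
    omega

/-- The highest weight of the dual of the module of highest weight `w`. -/
def dualWt {N : ℕ} (w : Fin N → ℤ) : Fin N → ℤ := fun i => -w (Fin.rev i)

theorem dualWt_dualWt {N : ℕ} (w : Fin N → ℤ) : dualWt (dualWt w) = w := by
  ext i; simp [dualWt]

theorem Antitone.dualWt {N : ℕ} {w : Fin N → ℤ} (hw : Antitone w) : Antitone (dualWt w) :=
  fun _ _ hij => neg_le_neg (hw (Fin.rev_le_rev.2 hij))

theorem dualWt_δwt (N : ℕ) : dualWt (δwt N) = (fun _ => 1 - (N : ℤ)) + δwt N := by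
  ext i
  simp [dualWt, δwt, Fin.val_rev]
  omega

theorem det_jacobiTrudi_dualWt {N : ℕ} (q : Fin N → ℤ) :
    (jacobiTrudi N (δwt N) (q + δwt N)).det =
      (jacobiTrudi N (dualWt q + δwt N) (δwt N)).det := by
  rw [← Matrix.det_transpose, ← Matrix.det_submatrix_equiv_self Fin.revPerm]
  congr 1
  ext1 i j
  simp only [jacobiTrudi, Matrix.submatrix_apply, Matrix.transpose_apply, Matrix.of_apply,
    Pi.add_apply]
  congr 1
  simp [δwt, dualWt, Fin.val_rev]
  omega

/-- The action of permutations of the coordinates on Laurent polynomials. -/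
def permAlg {N : ℕ} (σ : Equiv.Perm (Fin N)) :
    AddMonoidAlgebra ℂ (Fin N → ℤ) ≃ₐ[ℂ] AddMonoidAlgebra ℂ (Fin N → ℤ) :=
  AddMonoidAlgebra.domCongr ℂ ℂ (AddEquiv.arrowCongr σ (AddEquiv.refl ℤ))

theorem coeff_permAlg {N : ℕ} (σ : Equiv.Perm (Fin N)) (f : AddMonoidAlgebra ℂ (Fin N → ℤ))
    (v : Fin N → ℤ) : (permAlg σ f).coeff v = f.coeff (v ∘ σ) := by
  rw [permAlg, AddMonoidAlgebra.coeff_domCongr]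
  rfl

theorem permAlg_single {N : ℕ} (σ : Equiv.Perm (Fin N)) (w : Fin N → ℤ) (c : ℂ) :
    permAlg σ (AddMonoidAlgebra.single w c) = AddMonoidAlgebra.single (w ∘ σ.symm) c := by
  rw [permAlg, AddMonoidAlgebra.domCongr_single]
  rfl

theorem permAlg_aalt {N : ℕ} (σ : Equiv.Perm (Fin N)) (w : Fin N → ℤ) :
    permAlg σ (aalt N w) = ((Equiv.Perm.sign σ : ℤ) : ℂ) • aalt N w := by
  rw [aalt, map_sum, Finset.smul_sum]
  refine Fintype.sum_equiv (Equiv.mulRight σ⁻¹) _ _ fun τ => ?_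
  rw [map_smul, permAlg_single, smul_smul]
  congr 1
  simp only [Equiv.coe_mulRight, map_mul, Equiv.Perm.sign_inv, ← Int.cast_mul, ← Units.val_mul]
  rw [mul_left_comm, Int.units_mul_self, mul_one]

theorem permAlg_hsym {N : ℕ} (σ : Equiv.Perm (Fin N)) (m : ℤ) :
    permAlg σ (hsym N m) = hsym N m := by
  have h : PowerSeries.map (permAlg σ : _ →+* _) (hSeries N) = hSeries N := by
    rw [hSeries, map_prod]
    refine Fintype.prod_equiv σ _ _ fun j => ?_
    ext1 n
    simp only [PowerSeries.coeff_map, PowerSeries.coeff_mk, RingHom.coe_coe, permAlg_single]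
    congr 1
    ext i
    simp [Pi.single_apply, Equiv.symm_apply_eq]
  rw [hsym]
  split_ifs
  · conv_rhs => rw [← h]
    simp
  · simp

theorem permAlg_det_jacobiTrudi {N : ℕ} (σ : Equiv.Perm (Fin N)) (u v : Fin N → ℤ) :
    permAlg σ (jacobiTrudi N u v).det = (jacobiTrudi N u v).det := by
  simp [det_jacobiTrudi, map_sum, map_prod, permAlg_hsym]

/-- Any Laurent polynomial that is alternating under permutations of the variables is a linear
combination of the `aalt N u` with `u` strictly decreasing. -/
theorem eq_sum_aalt_of_alternating {N : ℕ} {f : AddMonoidAlgebra ℂ (Fin N → ℤ)}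
    (hf : ∀ σ, permAlg σ f = ((Equiv.Perm.sign σ : ℤ) : ℂ) • f) :
    f = ∑ᶠ u ∈ {u : Fin N → ℤ | StrictAnti u ∧ f.coeff u ≠ 0}, f.coeff u • aalt N u := by
  classical
  have hfin : {u : Fin N → ℤ | StrictAnti u ∧ f.coeff u ≠ 0}.Finite :=
    f.coeff.hasFiniteSupport.subset fun u hu => hu.2
  rw [finsum_mem_eq_finite_toFinset_sum _ hfin, ← sub_eq_zero]
  set g := f - ∑ u ∈ hfin.toFinset, f.coeff u • aalt N u with hg
  have hgalt (σ : Equiv.Perm (Fin N)) :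
      permAlg σ g = ((Equiv.Perm.sign σ : ℤ) : ℂ) • g := by
    simp only [hg, map_sub, hf, map_sum, map_smul, permAlg_aalt, smul_sub, Finset.smul_sum]
    congr 1
    exact Finset.sum_congr rfl fun u _ => smul_comm _ _ _
  have hgalt' (σ : Equiv.Perm (Fin N)) (v : Fin N → ℤ) :
      g.coeff (v ∘ σ) = ((Equiv.Perm.sign σ : ℤ) : ℂ) * g.coeff v := by
    rw [← coeff_permAlg, hgalt]; simp
  have hzero (v : Fin N → ℤ) (hv : StrictAnti v) : g.coeff v = 0 := by
    rw [hg, AddMonoidAlgebra.coeff_sub, Finsupp.sub_apply, AddMonoidAlgebra.coeff_sum,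
      Finsupp.finsetSum_apply, sub_eq_zero]
    have : ∀ u ∈ hfin.toFinset, (f.coeff u • aalt N u).coeff v =
        if u = v then f.coeff v else 0 := by
      intro u hu
      have hu' := (hfin.mem_toFinset.1 hu).1
      rw [AddMonoidAlgebra.coeff_smul, Finsupp.smul_apply, coeff_aalt_of_strictAnti hu' hv]
      split_ifs with h <;> simp [h]
    rw [Finset.sum_congr rfl this, Finset.sum_ite_eq']
    split_ifs with h
    · rfl
    · by_contra h'
      exact h (hfin.mem_toFinset.2 ⟨hv, h'⟩)
  ext v
  rw [AddMonoidAlgebra.coeff_zero, Finsupp.zero_apply]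
  by_cases hv : Function.Injective v
  · have h1 : Monotone ((fun i => -v i) ∘ Tuple.sort fun i => -v i) := Tuple.monotone_sort _
    have h2 : StrictAnti (v ∘ Tuple.sort fun i => -v i) := by
      refine Antitone.strictAnti_of_injective (fun i j hij => ?_)
        (hv.comp (Equiv.injective _))
      exact neg_le_neg_iff.1 (h1 hij)
    have h3 := hzero _ h2
    rw [hgalt'] at h3
    simpa using h3
  · obtain ⟨i, j, hij, hne⟩ : ∃ i j, v i = v j ∧ i ≠ j := by
      simpa [Function.Injective] using hv
    have h := hgalt' (Equiv.swap i j) v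
    have hvs : v ∘ Equiv.swap i j = v := by
      ext x
      by_cases hx : x = i
      · simp [hx, hij]
      by_cases hx' : x = j
      · simp [hx', hij]
      · simp [Equiv.swap_apply_of_ne_of_ne hx hx']
    rw [hvs, Equiv.Perm.sign_swap hne] at h
    simp at h
    linear_combination h / 2

theorem aalt_add_const (N : ℕ) (w : Fin N → ℤ) (c : ℤ) :
    aalt N ((fun _ => c) + w) = AddMonoidAlgebra.single (fun _ => c) 1 * aalt N w := by
  simp only [aalt, Finset.mul_sum, mul_smul_comm, AddMonoidAlgebra.single_mul_single, mul_one]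
  rfl

/-- The involution of Laurent polynomials induced by `dualWt`. -/
def dualAlg (N : ℕ) :
    AddMonoidAlgebra ℂ (Fin N → ℤ) ≃ₐ[ℂ] AddMonoidAlgebra ℂ (Fin N → ℤ) :=
  AddMonoidAlgebra.domCongr ℂ ℂ
    ((AddEquiv.arrowCongr Fin.revPerm (AddEquiv.refl ℤ)).trans (AddEquiv.neg _))

theorem coeff_dualAlg {N : ℕ} (f : AddMonoidAlgebra ℂ (Fin N → ℤ)) (v : Fin N → ℤ) :
    (dualAlg N f).coeff v = f.coeff (dualWt v) := by
  rw [dualAlg, AddMonoidAlgebra.coeff_domCongr]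
  rfl

theorem dualAlg_single {N : ℕ} (w : Fin N → ℤ) (c : ℂ) :
    dualAlg N (AddMonoidAlgebra.single w c) = AddMonoidAlgebra.single (dualWt w) c := by
  rw [dualAlg, AddMonoidAlgebra.domCongr_single]
  rfl

theorem dualAlg_aalt {N : ℕ} (w : Fin N → ℤ) : dualAlg N (aalt N w) = aalt N (dualWt w) := by
  rw [aalt, map_sum, aalt]
  refine Fintype.sum_equiv (Equiv.permCongr Fin.revPerm) _ _ fun σ => ?_
  rw [map_smul, dualAlg_single, Equiv.Perm.sign_permCongr]
  congr 2
  ext i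
  simp [dualWt]

/-- The family `s` of irreducible characters together with the Clebsch–Gordan coefficients. -/
structure IsCharacterSystem {N : ℕ} (s : (Fin N → ℤ) → AddMonoidAlgebra ℂ (Fin N → ℤ))
    (cg : (Fin N → ℤ) → (Fin N → ℤ) → (Fin N → ℤ) → ℕ) : Prop where
  weyl : ∀ α : Fin N → ℤ, aalt N (δwt N) * s α = aalt N (α + δwt N)
  antitone_of_ne_zero : ∀ α β γ, cg α β γ ≠ 0 → Antitone γ
  mul_eq : ∀ α β : Fin N → ℤ, Antitone α → Antitone β →
    {γ : Fin N → ℤ | cg α β γ ≠ 0}.Finite ∧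
      s α * s β = ∑ᶠ γ : Fin N → ℤ, (cg α β γ : ℂ) • s γ

namespace IsCharacterSystem

variable {N : ℕ} {s : (Fin N → ℤ) → AddMonoidAlgebra ℂ (Fin N → ℤ)}
  {cg : (Fin N → ℤ) → (Fin N → ℤ) → (Fin N → ℤ) → ℕ} {α β γ : Fin N → ℤ}

theorem coeff_aalt_mul_mul (h : IsCharacterSystem s cg) (hα : Antitone α) (hβ : Antitone β)
    (hγ : Antitone γ) :
    (aalt N (δwt N) * (s α * s β)).coeff (γ + δwt N) = cg α β γ := by
  classical
  obtain ⟨hfin, hmul⟩ := h.mul_eq α β hα hβ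
  have hsub : (Function.support fun γ => (cg α β γ : ℂ) • s γ) ⊆ ↑hfin.toFinset := by
    intro γ hγ
    rw [Set.Finite.coe_toFinset]
    intro h0
    exact hγ (by simp [h0])
  rw [hmul, finsum_eq_sum_of_support_subset _ hsub, Finset.mul_sum, AddMonoidAlgebra.coeff_sum,
    Finsupp.finsetSum_apply]
  have : ∀ κ ∈ hfin.toFinset, (aalt N (δwt N) * (cg α β κ : ℂ) • s κ).coeff (γ + δwt N) =
      if κ = γ then (cg α β γ : ℂ) else 0 := by
    intro κ hκ
    have hκ' := h.antitone_of_ne_zero α β κ (hfin.mem_toFinset.1 hκ)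
    rw [mul_smul_comm, h.weyl, AddMonoidAlgebra.coeff_smul, Finsupp.smul_apply,
      coeff_aalt_of_strictAnti hκ'.add_δwt hγ.add_δwt]
    by_cases hκγ : κ = γ <;> simp [hκγ]
  rw [Finset.sum_congr rfl this, Finset.sum_ite_eq']
  split_ifs with h0
  · rfl
  · have : cg α β γ = 0 := by simpa using h0
    simp [this]

theorem coeff_aalt_mul_eq (h : IsCharacterSystem s cg) (hα : Antitone α) (hβ : Antitone β)
    (hγ : Antitone γ) :
    (aalt N (β + δwt N) * s α).coeff (γ + δwt N) = cg α β γ := by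
  rw [← h.coeff_aalt_mul_mul hα hβ hγ, ← h.weyl, mul_comm (s α), mul_assoc]

theorem cg_comm (h : IsCharacterSystem s cg) (hα : Antitone α) (hβ : Antitone β)
    (hγ : Antitone γ) : cg α β γ = cg β α γ := by
  have := h.coeff_aalt_mul_mul hα hβ hγ
  rw [mul_comm (s α), h.coeff_aalt_mul_mul hβ hα hγ] at this
  exact_mod_cast this.symm

theorem dualAlg_aalt_δwt : dualAlg N (aalt N (δwt N)) =
    AddMonoidAlgebra.single (fun _ => 1 - (N : ℤ)) 1 * aalt N (δwt N) := by
  rw [dualAlg_aalt, dualWt_δwt, aalt_add_const]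

theorem dualWt_add_δwt (α : Fin N → ℤ) :
    dualWt (α + δwt N) = (fun _ => 1 - (N : ℤ)) + (dualWt α + δwt N) := by
  rw [add_left_comm, ← dualWt_δwt]
  ext i
  simp [dualWt, add_comm]

theorem dualAlg_character (h : IsCharacterSystem s cg) (α : Fin N → ℤ) :
    dualAlg N (s α) = s (dualWt α) := by
  refine aalt_δwt_cancel ?_
  have hne : (AddMonoidAlgebra.single (fun _ => 1 - (N : ℤ)) 1 :
      AddMonoidAlgebra ℂ (Fin N → ℤ)) ≠ 0 := by simp
  refine mul_left_cancel₀ hne ?_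
  rw [← mul_assoc, ← dualAlg_aalt_δwt, ← map_mul, h.weyl, h.weyl, dualAlg_aalt,
    dualWt_add_δwt, aalt_add_const]

theorem cg_dualWt (h : IsCharacterSystem s cg) (hα : Antitone α) (hβ : Antitone β)
    (hγ : Antitone γ) : cg (dualWt α) (dualWt β) (dualWt γ) = cg α β γ := by
  have h1 := h.coeff_aalt_mul_mul hα.dualWt hβ.dualWt hγ.dualWt
  have h2 := coeff_dualAlg (aalt N (δwt N) * (s α * s β)) (dualWt (γ + δwt N))
  rw [dualWt_dualWt, h.coeff_aalt_mul_mul hα hβ hγ, map_mul, map_mul, dualAlg_aalt_δwt,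
    h.dualAlg_character, h.dualAlg_character, mul_assoc, dualWt_add_δwt,
    AddMonoidAlgebra.coeff_single_mul_apply, one_mul, neg_add_cancel_left, h1] at h2
  exact_mod_cast h2

theorem coeff_character_comp (h : IsCharacterSystem s cg) (hα0 : 0 ≤ α)
    (w : Fin N → ℤ) (σ : Equiv.Perm (Fin N)) : (s α).coeff (w ∘ σ) = (s α).coeff w := by
  rw [coeff_character_eq hα0 (h.weyl α), coeff_character_eq hα0 (h.weyl α)]
  congr 3
  exact Equiv.prod_comp σ fun i => hsym N (w i)

theorem nonneg_of_coeff_character_ne_zero (h : IsCharacterSystem s cg) (hα0 : 0 ≤ α)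
    {w : Fin N → ℤ} (hw : (s α).coeff w ≠ 0) : 0 ≤ w := by
  intro i
  by_contra hi
  refine hw ?_
  rw [coeff_character_eq hα0 (h.weyl α),
    Finset.prod_eq_zero (Finset.mem_univ i) (hsym_of_neg N (not_le.1 hi))]
  simp

/-- The multiplicity of `L(γ)` in `L(α) ⊗ L(β)` equals that of `L(β)` in `L(α)* ⊗ L(γ)`. -/
theorem cg_adjoint (h : IsCharacterSystem s cg) (hα : Antitone α) (hα0 : 0 ≤ α)
    (hβ : Antitone β) (hγ : Antitone γ) : cg (dualWt α) γ β = cg α β γ := by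
  have h1 := h.coeff_aalt_mul_eq hα hβ hγ
  have h2 := h.coeff_aalt_mul_eq hα.dualWt hγ hβ
  rw [coeff_aalt_mul] at h1 h2
  have : (cg (dualWt α) γ β : ℂ) = cg α β γ := by
    rw [← h1, ← h2]
    refine Fintype.sum_equiv (Equiv.inv _) _ _ fun σ => ?_
    rw [← h.dualAlg_character, coeff_dualAlg]
    simp only [Equiv.inv_apply, Equiv.Perm.sign_inv]
    congr 1
    rw [← h.coeff_character_comp hα0 _ (Equiv.trans σ⁻¹ Fin.revPerm)]
    congr 1
    ext i
    simp [dualWt]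
  exact_mod_cast this

theorem last_eq_zero (h : IsCharacterSystem s cg) (hα : Antitone α) (hα0 : 0 ≤ α)
    (hβ : Antitone β) (hβ0 : 0 ≤ β) (hγ : Antitone γ) (hne : cg α β γ ≠ 0) (i : Fin N)
    (hi : (i : ℕ) + 1 = N) (hγi : γ i = 0) : β i = 0 := by
  have h1 := h.coeff_aalt_mul_eq hα hβ hγ
  have h2 : (cg α β γ : ℂ) ≠ 0 := by exact_mod_cast hne
  rw [← h1, coeff_aalt_mul] at h2
  obtain ⟨σ, -, hσ⟩ := Finset.exists_ne_zero_of_sum_ne_zero h2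
  have h3 := h.nonneg_of_coeff_character_ne_zero hα0 (right_ne_zero_of_mul hσ) i
  have h4 : β i ≤ β (σ i) := hβ (Fin.le_def.2 (by omega))
  have h5 := δwt_nonneg N (σ i)
  have h6 : δwt N i = 0 := by simp only [δwt]; omega
  have h7 := hβ0 i
  simp only [Pi.sub_apply, Pi.add_apply, Function.comp_apply, Pi.zero_apply] at *
  omega

/-- The Jacobi–Trudi determinant of a skew shape is the corresponding skew character. -/
theorem det_jacobiTrudi_eq (h : IsCharacterSystem s cg) (hα : Antitone α)
    (hγ : Antitone γ) :
    {κ : Fin N → ℤ | Antitone κ ∧ 0 ≤ κ ∧ cg α κ γ ≠ 0}.Finite ∧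
    (jacobiTrudi N (γ + δwt N) (α + δwt N)).det =
      ∑ᶠ κ ∈ {κ : Fin N → ℤ | Antitone κ ∧ 0 ≤ κ ∧ cg α κ γ ≠ 0}, (cg α κ γ : ℂ) • s κ := by
  set G := (jacobiTrudi N (γ + δwt N) (α + δwt N)).det with hG
  set f := aalt N (δwt N) * G with hf
  set S := {κ : Fin N → ℤ | Antitone κ ∧ 0 ≤ κ ∧ cg α κ γ ≠ 0} with hS
  have hcoeff (κ : Fin N → ℤ) (hκ : Antitone κ) (hκ0 : 0 ≤ κ) :
      f.coeff (κ + δwt N) = cg α κ γ := by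
    rw [hf, hG, coeff_aalt_mul_det_jacobiTrudi hκ0 (h.weyl κ), h.coeff_aalt_mul_eq hκ hα hγ,
      h.cg_comm hκ hα hγ]
  have himage : {u : Fin N → ℤ | StrictAnti u ∧ f.coeff u ≠ 0} = (· + δwt N) '' S := by
    ext u
    constructor
    · rintro ⟨hu, hne⟩
      have hu0 : 0 ≤ u := ((PolyHomog.aalt _ (δwt_nonneg N)).mul
        (polyHomog_det_jacobiTrudi N _ _) u hne).1
      have hκ := hu.antitone_sub_δwt
      have hκ0 := hu.nonneg_sub_δwt hu0
      refine ⟨u - δwt N, ⟨hκ, hκ0, fun h0 => hne ?_⟩, sub_add_cancel _ _⟩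
      rw [← sub_add_cancel u (δwt N), hcoeff _ hκ hκ0, h0, Nat.cast_zero]
    · rintro ⟨κ, ⟨hκ, hκ0, hne⟩, rfl⟩
      refine ⟨hκ.add_δwt, ?_⟩
      rw [hcoeff κ hκ hκ0]
      exact_mod_cast hne
  have hinj : Function.Injective (· + δwt N) := add_left_injective _
  have hfin : S.Finite := by
    refine Set.Finite.of_finite_image ?_ hinj.injOn
    rw [← himage]
    exact f.coeff.hasFiniteSupport.subset fun u hu => hu.2
  refine ⟨hfin, aalt_δwt_cancel ?_⟩
  have halt (σ : Equiv.Perm (Fin N)) :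
      permAlg σ f = ((Equiv.Perm.sign σ : ℤ) : ℂ) • f := by
    rw [hf, map_mul, permAlg_aalt, hG, permAlg_det_jacobiTrudi, smul_mul_assoc]
  rw [← hf, eq_sum_aalt_of_alternating halt, himage, finsum_mem_image hinj.injOn,
    finsum_mem_eq_finite_toFinset_sum _ hfin, finsum_mem_eq_finite_toFinset_sum _ hfin,
    Finset.mul_sum]
  refine Finset.sum_congr rfl fun κ hκ => ?_
  obtain ⟨hκ, hκ0, -⟩ := hfin.mem_toFinset.1 hκ
  rw [hcoeff κ hκ hκ0, mul_smul_comm, h.weyl]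

theorem cg_eq_finsum (h : IsCharacterSystem s cg) (n : ℕ) {μ p q lm : Fin N → ℤ}
    (hμ : Antitone μ) (hp : Antitone p) (hq : Antitone q) (hlm : Antitone lm)
    (hpq : Antitone (p + q)) (hp0 : 0 ≤ p) (hlm0 : lm ≤ 0) (hq0 : q ≤ 0)
    (hμn : ∀ i : Fin N, n ≤ i → μ i = 0) (hpn : ∀ i : Fin N, n ≤ i → p i = 0)
    (hqn : ∀ i : Fin N, i < n → q i = 0) :
    cg lm μ (p + q) = ∑ᶠ κ ∈ {κ : Fin N → ℤ | Antitone κ ∧ 0 ≤ κ ∧ cg p κ μ ≠ 0},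
      cg q (dualWt κ) lm * cg p κ μ := by
  obtain ⟨hfin, hdet⟩ := h.det_jacobiTrudi_eq hp hμ
  have hdual (w : Fin N → ℤ) (hw : w ≤ 0) : 0 ≤ dualWt w := fun i => neg_nonneg.2 (hw _)
  have h1 : cg lm μ (p + q) = cg (dualWt lm) (p + q) μ := by
    rw [← h.cg_adjoint hlm.dualWt (hdual _ hlm0) hpq hμ, dualWt_dualWt]
  have h2 : (cg (dualWt lm) (p + q) μ : ℂ) =
      ((jacobiTrudi N (μ + δwt N) (p + δwt N)).det * aalt N (dualWt q + δwt N)).coeff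
        (dualWt lm + δwt N) := by
    rw [← h.coeff_aalt_mul_eq hlm.dualWt hpq hμ,
      ← coeff_aalt_mul_det_jacobiTrudi (hdual _ hlm0) (h.weyl _),
      det_jacobiTrudi_add n μ p q hμn hpn hp0 hqn, mul_left_comm, det_jacobiTrudi_dualWt,
      aalt_mul_det_jacobiTrudi N _ (add_nonneg (hdual _ hq0) (δwt_nonneg N))]
  rw [finsum_mem_eq_finite_toFinset_sum _ hfin] at hdet ⊢
  rw [hdet, Finset.sum_mul, AddMonoidAlgebra.coeff_sum, Finsupp.finsetSum_apply] at h2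
  have h3 : (cg lm μ (p + q) : ℂ) =
      ∑ κ ∈ hfin.toFinset, (cg q (dualWt κ) lm : ℂ) * cg p κ μ := by
    rw [h1, h2]
    refine Finset.sum_congr rfl fun κ hκ => ?_
    obtain ⟨hκ, -, -⟩ := hfin.mem_toFinset.1 hκ
    rw [smul_mul_assoc, mul_comm (s κ), AddMonoidAlgebra.coeff_smul, Finsupp.smul_apply,
      h.coeff_aalt_mul_eq hκ hq.dualWt hlm.dualWt, h.cg_comm hκ hq.dualWt hlm.dualWt,
      ← h.cg_dualWt hq.dualWt hκ hlm.dualWt, dualWt_dualWt, dualWt_dualWt, smul_eq_mul,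
      mul_comm]
  exact_mod_cast h3

end IsCharacterSystem

theorem tailSum_eq_sum_range (l : ℕ →₀ ℕ) (j m : ℕ) (hm : ∀ i, m ≤ i → l i = 0) :
    tailSum l j = ∑ i ∈ Finset.range m, if j ≤ i then (l i : ℤ) else 0 := by
  refine Finset.sum_subset (fun i hi => ?_) fun i _ hi => ?_
  · by_contra h
    exact Finsupp.mem_support_iff.1 hi (hm i (by simpa using h))
  · simp [Finsupp.notMem_support_iff.1 hi]

theorem tailSum_succ (l : ℕ →₀ ℕ) (j : ℕ) : tailSum l j = l j + tailSum l (j + 1) := by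
  obtain ⟨m, hm⟩ : ∃ m, ∀ i, m ≤ i → l i = 0 := by
    refine ⟨l.support.sup id + 1, fun i hi => ?_⟩
    by_contra h
    have := Finset.le_sup (f := id) (Finsupp.mem_support_iff.2 h)
    simp only [id] at this
    omega
  have hm' : ∀ i, max m (j + 1) ≤ i → l i = 0 := fun i hi => hm i (le_of_max_le_left hi)
  rw [tailSum_eq_sum_range l j _ hm', tailSum_eq_sum_range l (j + 1) _ hm',
    ← Finset.add_sum_erase _ _ (Finset.mem_range.2 (show j < max m (j + 1) by simp)),
    ← Finset.add_sum_erase _ (fun i => if j + 1 ≤ i then (l i : ℤ) else 0)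
      (Finset.mem_range.2 (show j < max m (j + 1) by simp))]
  simp only [le_refl, if_true, Nat.not_succ_le_self, if_false, zero_add]
  congr 1
  refine Finset.sum_congr rfl fun i hi => ?_
  have := (Finset.mem_erase.1 hi).1
  exact if_congr (by omega) rfl rfl

theorem tailSum_nonneg (l : ℕ →₀ ℕ) (j : ℕ) : 0 ≤ tailSum l j :=
  Finset.sum_nonneg fun i _ => by split_ifs <;> positivity

theorem tailSum_antitone (l : ℕ →₀ ℕ) : Antitone (tailSum l) :=
  antitone_nat_of_succ_le fun j => by rw [tailSum_succ l j]; omega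

theorem eq_zero_of_tailSum_eq_zero {l : ℕ →₀ ℕ} {m : ℕ} (h : tailSum l m = 0) {i : ℕ}
    (hi : m ≤ i) : l i = 0 := by
  have h1 := tailSum_antitone l hi
  have h2 := tailSum_succ l i
  have h3 := tailSum_nonneg l (i + 1)
  omega

theorem Dplus_antitone (l : ℕ →₀ ℕ) (N : ℕ) : Antitone (Dplus l N) :=
  fun _ _ hij => tailSum_antitone l hij

theorem Dplus_nonneg (l : ℕ →₀ ℕ) (N : ℕ) : 0 ≤ Dplus l N := fun _ => tailSum_nonneg l _

theorem Dminus_eq_dualWt (l : ℕ →₀ ℕ) (N : ℕ) : Dminus l N = dualWt (Dplus l N) := by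
  ext i
  simp only [Dminus, dualWt, Dplus, Fin.val_rev]
  congr 2
  omega

/-- The map `l ↦ D₊` is a bijection from the Young diagrams with less than `N` rows onto
the partitions with `N` parts whose last part is zero. -/
theorem Dplus_bijOn (N : ℕ) (S : Set (Fin (N + 1) → ℤ))
    (hS : ∀ κ ∈ S, Antitone κ ∧ κ (Fin.last N) = 0) :
    Set.BijOn (fun l => Dplus l (N + 1)) {l | Dplus l (N + 1) ∈ S} S := by
  refine ⟨fun l hl => hl, fun l hl l' hl' heq => ?_, fun κ hκ => ?_⟩
  · have heq' (j : ℕ) (hj : j ≤ N) : tailSum l j = tailSum l' j :=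
      congrFun heq ⟨j, by omega⟩
    have h0 : tailSum l N = 0 := (hS _ hl).2
    have h0' : tailSum l' N = 0 := (hS _ hl').2
    ext i
    rcases le_or_gt N i with hi | hi
    · rw [eq_zero_of_tailSum_eq_zero h0 hi, eq_zero_of_tailSum_eq_zero h0' hi]
    · have h1 := tailSum_succ l i
      rw [heq' i hi.le, heq' (i + 1) hi, tailSum_succ l' i] at h1
      omega
  · obtain ⟨hanti, hlast⟩ := hS κ hκ
    let g : ℕ → ℕ := fun i => if hi : i < N then
      (κ ⟨i, by omega⟩ - κ ⟨i + 1, by omega⟩).toNat else 0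
    let l : ℕ →₀ ℕ := Finsupp.onFinset (Finset.range N) g fun i hi => by
      by_contra h
      exact hi (dif_neg (by simpa using h))
    have key (d : ℕ) : ∀ j (hj : j + d = N), tailSum l j = κ ⟨j, by omega⟩ := by
      induction d with
      | zero =>
        intro j hj
        obtain rfl : j = N := hj
        rw [tailSum_eq_sum_range l j j fun i hi => dif_neg (by omega)]
        refine (Finset.sum_eq_zero fun i hi => if_neg ?_).trans hlast.symm
        simpa using hi
      | succ d ih =>
        intro j hj
        have hg : l j = (κ ⟨j, by omega⟩ - κ ⟨j + 1, by omega⟩).toNat := dif_pos (by omega)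
        have := hanti (show (⟨j, by omega⟩ : Fin (N + 1)) ≤ ⟨j + 1, by omega⟩ from
          Fin.le_def.2 (Nat.le_succ j))
        rw [tailSum_succ, ih (j + 1) (by omega), hg]
        omega
    have hl : Dplus l (N + 1) = κ := by
      ext j
      exact key (N - j) j (by omega)
    exact ⟨l, by simpa [hl] using hκ, hl⟩

theorem frontPad_antitone {r : ℕ} {f : Fin r → ℤ} (hf : Antitone f) (hf0 : ∀ i, 0 ≤ f i)
    (N : ℕ) : Antitone (frontPad f N) := by
  intro i j hij
  have : (i : ℕ) ≤ j := hij
  simp only [frontPad, padF]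
  split_ifs with h1 h2
  · exact hf (Fin.le_def.2 this)
  · omega
  · exact hf0 _
  · rfl

theorem frontPad_nonneg {r : ℕ} {f : Fin r → ℤ} (hf0 : ∀ i, 0 ≤ f i) (N : ℕ) :
    0 ≤ frontPad f N := by
  intro i
  simp only [frontPad, padF, Pi.zero_apply]
  split_ifs
  · exact hf0 _
  · rfl

theorem frontPad_of_le {r : ℕ} (f : Fin r → ℤ) {N : ℕ} {i : Fin N} (hi : r ≤ i) :
    frontPad f N i = 0 := dif_neg (by omega)

theorem backPad_of_lt {r : ℕ} (f : Fin r → ℤ) {N : ℕ} {i : Fin N} (hi : (i : ℕ) < N - r) :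
    backPad f N i = 0 := if_neg (by omega)

theorem backPad_antitone {r : ℕ} {f : Fin r → ℤ} (hf : Antitone f) (hf0 : ∀ i, f i ≤ 0)
    {N : ℕ} (hN : r ≤ N) : Antitone (backPad f N) := by
  intro i j hij
  have : (i : ℕ) ≤ j := hij
  simp only [backPad, padF]
  split_ifs
  all_goals first
    | omega
    | exact hf (Fin.le_def.2 (by simp only; omega))
    | exact hf0 _

theorem backPad_nonpos {r : ℕ} {f : Fin r → ℤ} (hf0 : ∀ i, f i ≤ 0) (N : ℕ) :
    backPad f N ≤ 0 := by
  intro i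
  simp only [backPad, padF, Pi.zero_apply]
  split_ifs
  · exact hf0 _
  · rfl
  · rfl

theorem reciprocity_formula
    (k t a b : ℕ)
    (νpos : Fin k → ℤ) (hνpos : Antitone νpos) (hνpos' : ∀ i, 0 < νpos i)
    (νneg : Fin t → ℤ) (hνneg : Antitone νneg) (hνneg' : ∀ i, νneg i < 0)
    (μp : Fin a → ℤ) (hμp : Antitone μp) (hμp' : ∀ i, 0 ≤ μp i)
    (lm : Fin b → ℤ) (hlm : Antitone lm) (hlm' : ∀ i, lm i ≤ 0) :
    ∃ N₀ : ℕ, ∀ N : ℕ, N₀ ≤ N →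
      -- s : the irreducible characters, via the Weyl character formula
      ∀ s : (Fin N → ℤ) → AddMonoidAlgebra ℂ (Fin N → ℤ),
        (∀ α : Fin N → ℤ, aalt N (δwt N) * s α = aalt N (fun i => α i + δwt N i)) →
      -- cg : the Clebsch–Gordan coefficients
      ∀ cg : (Fin N → ℤ) → (Fin N → ℤ) → (Fin N → ℤ) → ℕ,
        (∀ α β γ, cg α β γ ≠ 0 → Antitone γ) →
        (∀ α β : Fin N → ℤ, Antitone α → Antitone β →
          {γ : Fin N → ℤ | cg α β γ ≠ 0}.Finite ∧
          s α * s β = ∑ᶠ γ : Fin N → ℤ, (cg α β γ : ℂ) • s γ) →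
      -- the reciprocity formula
      ({l : ℕ →₀ ℕ |
          cg (backPad νneg N) (Dminus l N) (backPad lm N) *
            cg (frontPad νpos N) (Dplus l N) (frontPad μp N) ≠ 0}.Finite ∧
        (∑ᶠ l : ℕ →₀ ℕ,
          cg (backPad νneg N) (Dminus l N) (backPad lm N) *
            cg (frontPad νpos N) (Dplus l N) (frontPad μp N)) =
          cg (backPad lm N) (frontPad μp N)
            (fun i => frontPad νpos N i + backPad νneg N i)) := by
  refine ⟨k + t + a + b + 1, fun N hN s hs cg hcg hmul => ?_⟩
  obtain ⟨N, rfl⟩ : ∃ M, N = M + 1 := ⟨N - 1, by omega⟩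
  have h : IsCharacterSystem s cg := ⟨hs, hcg, hmul⟩
  have hp := frontPad_antitone hνpos (fun i => (hνpos' i).le) (N + 1)
  have hp0 := frontPad_nonneg (fun i => (hνpos' i).le) (N + 1)
  have hμ := frontPad_antitone hμp hμp' (N + 1)
  have hq := backPad_antitone hνneg (fun i => (hνneg' i).le) (N := N + 1) (by omega)
  have hq0 := backPad_nonpos (fun i => (hνneg' i).le) (N + 1)
  have hl := backPad_antitone hlm hlm' (N := N + 1) (by omega)
  have hl0 := backPad_nonpos hlm' (N + 1)
  set p := frontPad νpos (N + 1)
  set q := backPad νneg (N + 1)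
  set μ := frontPad μp (N + 1)
  set lam := backPad lm (N + 1)
  set S := {κ : Fin (N + 1) → ℤ | Antitone κ ∧ 0 ≤ κ ∧ cg p κ μ ≠ 0}
  have hbij := Dplus_bijOn N S fun κ hκ => ⟨hκ.1, h.last_eq_zero hp hp0 hκ.1 hκ.2.1 hμ hκ.2.2
    (Fin.last N) rfl (frontPad_of_le μp (by rw [Fin.val_last]; omega))⟩
  have hS : S.Finite := (h.det_jacobiTrudi_eq hp hμ).1
  have hsub : {l | cg q (Dminus l (N + 1)) lam * cg p (Dplus l (N + 1)) μ ≠ 0} ⊆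
      {l | Dplus l (N + 1) ∈ S} := fun l hl =>
    ⟨Dplus_antitone l _, Dplus_nonneg l _, right_ne_zero_of_mul hl⟩
  refine ⟨(hbij.finite_iff_finite.2 hS).subset hsub, ?_⟩
  have hfinsum := h.cg_eq_finsum (N + 1 - t) hμ hp hq hl (hp.add hq) hp0 hl0 hq0
    (fun i hi => frontPad_of_le μp (by omega)) (fun i hi => frontPad_of_le νpos (by omega))
    (fun i hi => backPad_of_lt νneg hi)
  refine Eq.trans ?_ hfinsum.symm
  rw [← finsum_mem_eq_of_bijOn (fun l => Dplus l (N + 1)) hbij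
      (f := fun l => cg q (Dminus l (N + 1)) lam * cg p (Dplus l (N + 1)) μ)
      fun l _ => by rw [Dminus_eq_dualWt],
    ← finsum_mem_univ]
  exact finsum_mem_inter_support_eq' _ _ _ fun l hl => ⟨fun _ => hsub hl, fun _ => trivial⟩

end
end
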